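/- arXiv:1209.0501 — 6 statements merged into one kernel-verified Lean document; each statement's English description precedes it below -/
import Mathlib

section
/- Let X and Y be infinite-dimensional real Banach spaces, let S be a subset of X, and let T be a uniform quotient map from S onto Y which is Lipschitz for large distances. Let t₀ ∈ (0,1]. Assume that there exists α ∈ [0,1] such that for every y in the unit sphere of Y and every η > 0 there exists a normalized 2-basic sequence (eₙ) in Y with ‖y ± t₀eₙ‖ ≤ 1 + α + η for every n ≥ 1. Then (2/3)·β̄_X(C^T t₀ / (12 L₁^T)) ≤ α. -/
open Set Metric Filter Topology

noncomputable section

/-- `T` is a uniform quotient map on `S`: uniformly continuous and co-uniformly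
continuous (with closed balls). -/
def UniformQuotientOn {X Y : Type*} [NormedAddCommGroup X] [NormedAddCommGroup Y]
    (T : X → Y) (S : Set X) : Prop :=
  (∀ ε > 0, ∃ δ > 0, ∀ x ∈ S, ∀ x' ∈ S, ‖x - x'‖ ≤ δ → ‖T x - T x'‖ ≤ ε) ∧
  (∀ ε > 0, ∃ δ > 0, ∀ x ∈ S, closedBall (T x) δ ⊆ T '' (closedBall x ε ∩ S))

/-- The set of ratios `‖Tx - Tx'‖ / ‖x - x'‖` over pairs of points of `S` at distance `≥ d`. -/
def LargeDistRatioSet {X Y : Type*} [NormedAddCommGroup X] [NormedAddCommGroup Y]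
    (T : X → Y) (S : Set X) (d : ℝ) : Set ℝ :=
  {r | ∃ x ∈ S, ∃ x' ∈ S, d ≤ ‖x - x'‖ ∧ r = ‖T x - T x'‖ / ‖x - x'‖}

/-- `L_d^T`, the Lipschitz constant of `T` for distances `≥ d`. -/
noncomputable def Ld {X Y : Type*} [NormedAddCommGroup X] [NormedAddCommGroup Y]
    (T : X → Y) (S : Set X) (d : ℝ) : ℝ :=
  sSup (LargeDistRatioSet T S d)

/-- `T` is Lipschitz for large distances: `L_d^T < ∞` for every `d > 0`. -/
def LipschitzLargeDist {X Y : Type*} [NormedAddCommGroup X] [NormedAddCommGroup Y]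
    (T : X → Y) (S : Set X) : Prop :=
  ∀ d > 0, BddAbove (LargeDistRatioSet T S d)

/-- The set of co-Lipschitz constants valid for all radii `r ≥ d`. -/
def CoLipSet {X Y : Type*} [NormedAddCommGroup X] [NormedAddCommGroup Y]
    (T : X → Y) (S : Set X) (d : ℝ) : Set ℝ :=
  {c | 0 < c ∧ ∀ r, d ≤ r → ∀ x ∈ S, ∀ y : Y, ‖y - T x‖ < c * r →
      y ∈ T '' (closedBall x r ∩ S)}

/-- `c_d^T`. -/
noncomputable def cdT {X Y : Type*} [NormedAddCommGroup X] [NormedAddCommGroup Y]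
    (T : X → Y) (S : Set X) (d : ℝ) : ℝ :=
  sSup (CoLipSet T S d)

/-- `C^T = lim_{d → ∞} c_d^T` (the limit of the nondecreasing family `c_d^T`,
i.e. its supremum). -/
noncomputable def CT {X Y : Type*} [NormedAddCommGroup X] [NormedAddCommGroup Y]
    (T : X → Y) (S : Set X) : ℝ :=
  sSup {c | ∃ d, 0 < d ∧ c = cdT T S d}

/-- The set of admissible `δ`'s in the definition of the modulus `β̄_X(t)`. -/
def betaModSet (X : Type*) [NormedAddCommGroup X] (t : ℝ) : Set ℝ :=
  {δ | 0 ≤ δ ∧ ∀ x ∈ closedBall (0 : X) 1, ∀ xs : ℕ → X,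
      (∀ n, xs n ∈ closedBall (0 : X) 1) →
      (∀ m n, m ≠ n → t ≤ ‖xs m - xs n‖) →
      ∃ n, ‖x - xs n‖ / 2 ≤ 1 - δ}

/-- The modulus `β̄_X(t)` of property (β) of Rolewicz. -/
noncomputable def betaMod (X : Type*) [NormedAddCommGroup X] (t : ℝ) : ℝ :=
  sSup (betaModSet X t)

/-- Property (β) of Rolewicz. -/
def PropertyBeta (X : Type*) [NormedAddCommGroup X] : Prop :=
  ∃ a, 1 ≤ a ∧ a ≤ 2 ∧ ∀ t, 0 < t → t ≤ a → ∃ δ, 0 < δ ∧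
    ∀ x ∈ closedBall (0 : X) 1, ∀ xs : ℕ → X,
      (∀ n, xs n ∈ closedBall (0 : X) 1) →
      (∀ m n, m ≠ n → t ≤ ‖xs m - xs n‖) →
      ∃ n, ‖x - xs n‖ / 2 ≤ 1 - δ

/-- `Z` is a closed subspace of finite codimension. -/
def FinCodim {Y : Type*} [NormedAddCommGroup Y] [NormedSpace ℝ Y] (Z : Subspace ℝ Y) : Prop :=
  IsClosed (Z : Set Y) ∧ FiniteDimensional ℝ (Y ⧸ Z)

/-- `ρ̄_Y(t, y) = inf_Z sup_{z ∈ S_Z} (‖y + tz‖ - 1)`. -/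
noncomputable def rhoAt {Y : Type*} [NormedAddCommGroup Y] [NormedSpace ℝ Y]
    (t : ℝ) (y : Y) : ℝ :=
  sInf {s | ∃ Z : Subspace ℝ Y, FinCodim Z ∧
    s = sSup {r | ∃ z ∈ Z, ‖z‖ = 1 ∧ r = ‖y + t • z‖ - 1}}

/-- The modulus of asymptotic uniform smoothness `ρ̄_Y(t)`. -/
noncomputable def rhoMod (Y : Type*) [NormedAddCommGroup Y] [NormedSpace ℝ Y] (t : ℝ) : ℝ :=
  sSup {r | ∃ y : Y, ‖y‖ = 1 ∧ r = rhoAt t y}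

/-- `δ̄_Y(t, y) = sup_Z inf_{z ∈ S_Z} (‖y + tz‖ - 1)`. -/
noncomputable def deltaAt {Y : Type*} [NormedAddCommGroup Y] [NormedSpace ℝ Y]
    (t : ℝ) (y : Y) : ℝ :=
  sSup {s | ∃ Z : Subspace ℝ Y, FinCodim Z ∧
    s = sInf {r | ∃ z ∈ Z, ‖z‖ = 1 ∧ r = ‖y + t • z‖ - 1}}

/-- The modulus of asymptotic uniform convexity `δ̄_Y(t)`. -/
noncomputable def deltaMod (Y : Type*) [NormedAddCommGroup Y] [NormedSpace ℝ Y] (t : ℝ) : ℝ :=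
  sInf {r | ∃ y : Y, ‖y‖ = 1 ∧ r = deltaAt t y}

/-- The norm of `Y` is asymptotically uniformly smooth. -/
def AUS (Y : Type*) [NormedAddCommGroup Y] [NormedSpace ℝ Y] : Prop :=
  Tendsto (fun t => rhoMod Y t / t) (𝓝[>] 0) (𝓝 0)

/-- The norm of `Y` is asymptotically uniformly convex. -/
def AUC (Y : Type*) [NormedAddCommGroup Y] [NormedSpace ℝ Y] : Prop :=
  ∀ t > 0, 0 < deltaMod Y t

/-- A sequence is basic with basis constant at most `K`. -/
def IsBasicWithConst {Y : Type*} [NormedAddCommGroup Y] [NormedSpace ℝ Y]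
    (K : ℝ) (e : ℕ → Y) : Prop :=
  ∀ (a : ℕ → ℝ) (m n : ℕ), m ≤ n →
    ‖∑ i ∈ Finset.range m, a i • e i‖ ≤ K * ‖∑ i ∈ Finset.range n, a i • e i‖

/-- A weakly null sequence. -/
def WeaklyNull {Y : Type*} [NormedAddCommGroup Y] [NormedSpace ℝ Y] (xs : ℕ → Y) : Prop :=
  ∀ f : Y →L[ℝ] ℝ, Tendsto (fun n => f (xs n)) atTop (𝓝 0)

/-- Property (M) of Kalton. -/
def PropertyM (Y : Type*) [NormedAddCommGroup Y] [NormedSpace ℝ Y] : Prop :=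
  ∀ u v : Y, ‖u‖ = 1 → ‖v‖ = 1 → ∀ xs : ℕ → Y, WeaklyNull xs →
    limsup (fun n => ‖u + xs n‖) atTop = limsup (fun n => ‖v + xs n‖) atTop

/-- `N` is a norm on `X` equivalent to the given one. -/
def IsEquivNorm {X : Type*} [NormedAddCommGroup X] [NormedSpace ℝ X] (N : X → ℝ) : Prop :=
  (∀ x y, N (x + y) ≤ N x + N y) ∧
  (∀ (a : ℝ) (x : X), N (a • x) = |a| * N x) ∧
  (∃ c > 0, ∃ C > 0, ∀ x : X, c * ‖x‖ ≤ N x ∧ N x ≤ C * ‖x‖)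

/-- The norm `N` has property (β) of Rolewicz. -/
def NormHasPropertyBeta {X : Type*} [NormedAddCommGroup X] (N : X → ℝ) : Prop :=
  ∃ a, 1 ≤ a ∧ a ≤ 2 ∧ ∀ t, 0 < t → t ≤ a → ∃ δ, 0 < δ ∧
    ∀ x : X, N x ≤ 1 → ∀ xs : ℕ → X, (∀ n, N (xs n) ≤ 1) →
      (∀ m n, m ≠ n → t ≤ N (xs m - xs n)) →
      ∃ n, N (x - xs n) / 2 ≤ 1 - δ

theorem aux_sep {Y : Type*} [NormedAddCommGroup Y] [NormedSpace ℝ Y] (e : ℕ → Y)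
    (h1 : ∀ n, ‖e n‖ = 1) (hb : IsBasicWithConst 2 e) (m n : ℕ) (hmn : m < n) :
    1 / 2 ≤ ‖e m - e n‖ := by
  have h := hb (fun i => (if i = m then 1 else 0) - (if i = n then 1 else 0)) (m+1) (n+1) (by omega)
  have e1 : ∑ i ∈ Finset.range (m+1), ((if i = m then (1:ℝ) else 0) - (if i = n then 1 else 0)) • e i
      = e m := by
    simp [sub_smul, Finset.sum_sub_distrib, ite_smul, Finset.sum_ite_eq']
    intro h; omega
  have e2 : ∑ i ∈ Finset.range (n+1), ((if i = m then (1:ℝ) else 0) - (if i = n then 1 else 0)) • e i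
      = e m - e n := by
    simp [sub_smul, Finset.sum_sub_distrib, ite_smul, Finset.sum_ite_eq']
    intro h; omega
  rw [e1, e2, h1] at h
  linarith

theorem aux_sep' {Y : Type*} [NormedAddCommGroup Y] [NormedSpace ℝ Y] (e : ℕ → Y)
    (h1 : ∀ n, ‖e n‖ = 1) (hb : IsBasicWithConst 2 e) (m n : ℕ) (hmn : m ≠ n) :
    1 / 2 ≤ ‖e m - e n‖ := by
  rcases lt_or_gt_of_ne hmn with h | h
  · exact aux_sep e h1 hb m n h
  · rw [norm_sub_rev]; exact aux_sep e h1 hb n m h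

theorem aux_L {X Y : Type*} [NormedAddCommGroup X] [NormedAddCommGroup Y]
    (S : Set X) (T : X → Y) (hLip : LipschitzLargeDist T S) (d : ℝ) (hd : 0 < d)
    (x : X) (hx : x ∈ S) (x' : X) (hx' : x' ∈ S) (h : d ≤ ‖x - x'‖) :
    ‖T x - T x'‖ ≤ Ld T S d * ‖x - x'‖ := by
  have : ‖T x - T x'‖ / ‖x - x'‖ ≤ Ld T S d :=
    le_csSup (hLip d hd) ⟨x, hx, x', hx', h, rfl⟩
  rwa [div_le_iff₀ (by linarith)] at this

theorem aux_L0 {X Y : Type*} [NormedAddCommGroup X] [NormedAddCommGroup Y]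
    (S : Set X) (T : X → Y) (d : ℝ) : 0 ≤ Ld T S d := by
  apply Real.sSup_nonneg
  rintro r ⟨x, _, x', _, _, rfl⟩
  positivity

theorem aux_K {X Y : Type*} [NormedAddCommGroup X] [NormedAddCommGroup Y]
    (S : Set X) (T : X → Y) (hT : UniformQuotientOn T S) (hLip : LipschitzLargeDist T S) :
    ∃ K : ℝ, 0 ≤ K ∧ ∀ x ∈ S, ∀ x' ∈ S, ‖x - x'‖ ≤ 1 → ‖T x - T x'‖ ≤ K := by
  obtain ⟨d, hd, h⟩ := hT.1 1 one_pos
  have h0 := aux_L0 S T d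
  refine ⟨1 + Ld T S d, by linarith, fun x hx x' hx' hxx => ?_⟩
  rcases le_total ‖x - x'‖ d with h1 | h1
  · linarith [h x hx x' hx' h1]
  · have := aux_L S T hLip d hd x hx x' hx' h1
    nlinarith

theorem aux_bdd {X Y : Type*} [NormedAddCommGroup X] [NormedAddCommGroup Y] [NormedSpace ℝ Y]
    [Nontrivial Y]
    (S : Set X) (T : X → Y) (hS : S.Nonempty)
    (hT : UniformQuotientOn T S) (hLip : LipschitzLargeDist T S) :
    ∃ B : ℝ, ∀ d, ∀ c ∈ CoLipSet T S d, c ≤ B := by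
  obtain ⟨K, hK0, hK⟩ := aux_K S T hT hLip
  refine ⟨2 * (Ld T S 1 + K), ?_⟩
  rintro d c ⟨hc, h⟩
  obtain ⟨x, hx⟩ := hS
  set r := max d 1 with hr
  have hr1 : 1 ≤ r := le_max_right _ _
  obtain ⟨v, hv⟩ := exists_norm_eq Y (c := c * r / 2) (by positivity)
  obtain ⟨x', ⟨hx'b, hx'⟩, hTx⟩ := h r (le_max_left _ _) x hx (T x + v)
    (by rw [add_sub_cancel_left, hv]; nlinarith [mul_pos hc (by linarith : 0 < r)])
  rw [mem_closedBall, dist_eq_norm] at hx'b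
  have hn : ‖T x' - T x‖ = c * r / 2 := by rw [hTx, add_sub_cancel_left, hv]
  have h0 := aux_L0 S T 1
  have : c * r / 2 ≤ (Ld T S 1 + K) * r := by
    rcases le_total ‖x' - x‖ 1 with h1 | h1
    · have := hK x' hx' x hx h1
      nlinarith
    · have := aux_L S T hLip 1 one_pos x' hx' x hx h1
      nlinarith
  nlinarith

theorem aux_beta0 (X : Type*) [NormedAddCommGroup X] [NormedSpace ℝ X] [Nontrivial X] :
    betaMod X 0 ≤ 0 := by
  apply Real.sSup_le _ le_rfl
  rintro δ ⟨_, h⟩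
  obtain ⟨v, hv⟩ := exists_norm_eq X (c := 1) zero_le_one
  obtain ⟨n, hn⟩ := h v (by simp [hv]) (fun _ => -v) (by simp [hv]) (by simp)
  have : ‖v - -v‖ = 2 := by
    rw [sub_neg_eq_add, ← two_smul ℝ, norm_smul, hv]; simp
  rw [this] at hn
  linarith

theorem aux_eta (α b : ℝ) (h : α < b) (hα : 0 ≤ α) :
    ∃ η : ℝ, 0 < η ∧ η ≤ 1 / 2 ∧ (1 + α + η) * (1 - b) * (1 + η) < 1 - η := by
  have hc : ContinuousAt (fun η : ℝ => (1 - η) - (1 + α + η) * (1 - b) * (1 + η)) 0 := by fun_prop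
  have h0 : (0:ℝ) < (fun η : ℝ => (1 - η) - (1 + α + η) * (1 - b) * (1 + η)) 0 := by
    simp only; nlinarith
  have h1 := hc.eventually (lt_mem_nhds h0)
  have h2 : ∀ᶠ η : ℝ in 𝓝[>] 0, 0 < (1 - η) - (1 + α + η) * (1 - b) * (1 + η) :=
    h1.filter_mono nhdsWithin_le_nhds
  have h3 : ∀ᶠ η : ℝ in 𝓝[>] 0, η ∈ Ioc (0:ℝ) (1/2) := Ioc_mem_nhdsGT (by norm_num)
  obtain ⟨η, ha, hb⟩ := (h2.and h3).exists
  exact ⟨η, hb.1, hb.2, by linarith⟩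

set_option maxHeartbeats 1600000 in
/-- Theorem `basis`. -/
theorem stmt0 {X Y : Type*} [NormedAddCommGroup X] [NormedSpace ℝ X] [CompleteSpace X]
    [NormedAddCommGroup Y] [NormedSpace ℝ Y] [CompleteSpace Y]
    (hX : ¬ FiniteDimensional ℝ X) (hY : ¬ FiniteDimensional ℝ Y)
    (S : Set X) (T : X → Y) (hsurj : T '' S = Set.univ)
    (hT : UniformQuotientOn T S) (hLip : LipschitzLargeDist T S)
    (t₀ : ℝ) (ht₀ : 0 < t₀) (ht₀' : t₀ ≤ 1)
    (α : ℝ) (hα₀ : 0 ≤ α) (hα₁ : α ≤ 1)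
    (hbasic : ∀ y : Y, ‖y‖ = 1 → ∀ η > 0, ∃ e : ℕ → Y,
      (∀ n, ‖e n‖ = 1) ∧ IsBasicWithConst 2 e ∧
      ∀ n, ‖y + t₀ • e n‖ ≤ 1 + α + η ∧ ‖y - t₀ • e n‖ ≤ 1 + α + η) :
    (2 / 3) * betaMod X (CT T S * t₀ / (12 * Ld T S 1)) ≤ α := by
  have hXn : Nontrivial X := by
    by_contra hn
    rw [not_nontrivial_iff_subsingleton] at hn
    exact hX inferInstance
  have hYn : Nontrivial Y := by
    by_contra hn
    rw [not_nontrivial_iff_subsingleton] at hn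
    exact hY inferInstance
  have hSn : S.Nonempty := by
    have : (T '' S).Nonempty := by rw [hsurj]; exact univ_nonempty
    exact this.of_image
  obtain ⟨B, hB⟩ := aux_bdd S T hSn hT hLip
  obtain ⟨K, hK0, hK⟩ := aux_K S T hT hLip
  have hL0 := aux_L0 S T 1
  have hCd0 : ∀ d, 0 ≤ cdT T S d := fun d => Real.sSup_nonneg fun c hc => hc.1.le
  have hC0 : 0 ≤ CT T S := by
    apply Real.sSup_nonneg
    rintro c ⟨d, _, rfl⟩
    exact hCd0 d
  rcases hL0.eq_or_lt with hL | hL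
  · rw [← hL]
    simp only [mul_zero, div_zero]
    linarith [aux_beta0 X]
  rcases hC0.eq_or_lt with hC | hC
  · rw [← hC]
    simp only [zero_mul, zero_div]
    linarith [aux_beta0 X]
  set C := CT T S with hCdef
  set L := Ld T S 1 with hLdef
  suffices hs : betaMod X (C * t₀ / (12 * L)) ≤ 3 / 2 * α by linarith
  apply Real.sSup_le _ (by linarith)
  rintro δ ⟨hδ0, hδ⟩
  by_contra! hlt
  obtain ⟨η, hη0, hη1, hη⟩ := aux_eta α (2/3*δ) (by linarith) hα₀
  -- choose c
  have hCpp : C * (1 - η) < C := by nlinarith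
  have hCpp0 : 0 < C * (1 - η) := by apply mul_pos hC; linarith
  have hne : {c | ∃ d, 0 < d ∧ c = cdT T S d}.Nonempty := ⟨_, 1, one_pos, rfl⟩
  obtain ⟨_, ⟨d₀, hd₀, rfl⟩, hcd⟩ := exists_lt_of_lt_csSup hne hCpp
  have hne2 : (CoLipSet T S d₀).Nonempty := by
    by_contra hemp
    rw [not_nonempty_iff_eq_empty] at hemp
    rw [cdT, hemp, Real.sSup_empty] at hcd
    linarith
  obtain ⟨c, hcmem, hcc⟩ := exists_lt_of_lt_csSup hne2 hcd
  obtain ⟨hc0, hc⟩ := hcmem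
  -- choose d
  set d := 3 * d₀ + 6 * (K + 1) / (c * t₀) with hd
  have hq0 : 0 < 6 * (K + 1) / (c * t₀) := by positivity
  have hct : 6 * (K + 1) < c * t₀ * d := by
    have : c * t₀ * (6 * (K + 1) / (c * t₀)) = 6 * (K + 1) := by field_simp
    rw [hd, mul_add (c * t₀), this]
    have : 0 < c * t₀ * (3 * d₀) := by positivity
    linarith
  have hnot : C * (1 + η) ∉ CoLipSet T S d := by
    intro hm
    have h1 : C * (1 + η) ≤ cdT T S d := le_csSup ⟨B, fun c hc => hB d c hc⟩ hm
    have h2 : cdT T S d ≤ C := by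
      apply le_csSup
      · by_contra hnb
        rw [hCdef, CT, Real.sSup_of_not_bddAbove hnb] at hC
        exact lt_irrefl _ hC
      · exact ⟨d, by linarith, rfl⟩
    nlinarith
  have hex : ∃ r, d ≤ r ∧ ∃ x ∈ S, ∃ y : Y, ‖y - T x‖ < C * (1 + η) * r ∧
      y ∉ T '' (closedBall x r ∩ S) := by
    by_contra! hcon
    exact hnot ⟨by positivity, hcon⟩
  obtain ⟨r, hr, x, hx, y, hyR, hyn⟩ := hex
  set R := ‖y - T x‖ with hRdef
  have hr0 : 0 < r := by linarith
  have hRc : c * r ≤ R := by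
    by_contra! hcon
    exact hyn (hc r (by linarith) x hx y hcon)
  have hR0 : 0 < R := lt_of_lt_of_le (by positivity) hRc
  have hRK : K < R * t₀ / 6 := by
    have h1 : c * t₀ * d ≤ c * t₀ * r := by gcongr
    have h2 : c * r * t₀ ≤ R * t₀ := by gcongr
    linarith
  set u : Y := R⁻¹ • (y - T x) with hu
  have hun : ‖u‖ = 1 := by
    rw [hu, norm_smul, ← hRdef, norm_inv, Real.norm_of_nonneg hR0.le]; field_simp
  have hRu : R • u = y - T x := by
    rw [hu, smul_smul, mul_inv_cancel₀ hR0.ne', one_smul]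
  obtain ⟨e, he1, heb, he⟩ := hbasic u hun η hη0
  set A := 1 + α + η with hA
  have hA1 : 1 ≤ A := by linarith
  set ρ := R / 3 * A / (C * (1 - η)) with hρ
  have hρC : C * (1 - η) * ρ = R / 3 * A := by
    rw [hρ, mul_div_cancel₀ _ hCpp0.ne']
  have hρ0 : 0 < ρ := by positivity
  have hcρ : R / 3 * A < c * ρ := by
    rw [← hρC]; gcongr
  have hρd : d₀ ≤ ρ := by
    rw [hρ, le_div_iff₀ hCpp0]
    have h1 : d₀ * (C * (1 - η)) ≤ r / 3 * c := by
      apply mul_le_mul _ hcc.le hCpp0.le (by positivity)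
      linarith
    nlinarith
  -- midpoint
  obtain ⟨p, ⟨hpb, hpS⟩, hTp⟩ := hc ρ hρd x hx (T x + (R / 3) • u) (by
    rw [add_sub_cancel_left, norm_smul, hun, Real.norm_of_nonneg (by positivity)]
    nlinarith)
  rw [mem_closedBall, dist_eq_norm] at hpb
  have hlift : ∀ n, ∃ w ∈ S, ‖w - p‖ ≤ ρ ∧ T w = T p + (R / 3) • (u + t₀ • e n) := by
    intro n
    obtain ⟨w, ⟨hwb, hwS⟩, hTw⟩ := hc ρ hρd p hpS (T p + (R / 3) • (u + t₀ • e n)) (by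
      rw [add_sub_cancel_left, norm_smul, Real.norm_of_nonneg (by positivity)]
      refine lt_of_le_of_lt ?_ hcρ
      gcongr
      exact (he n).1)
    rw [mem_closedBall, dist_eq_norm] at hwb
    exact ⟨w, hwS, hwb, hTw⟩
  choose w hwS hwb hTw using hlift
  have hsc : ∀ v : X, ‖ρ⁻¹ • v‖ = ‖v‖ / ρ := by
    intro v
    rw [norm_smul, norm_inv, Real.norm_of_nonneg hρ0.le]; field_simp
  obtain ⟨n, hn⟩ := hδ (ρ⁻¹ • (x - p))
    (by rw [mem_closedBall_zero_iff, hsc, div_le_one hρ0, norm_sub_rev]; exact hpb)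
    (fun n => ρ⁻¹ • (w n - p))
    (by intro n; rw [mem_closedBall_zero_iff, hsc, div_le_one hρ0]; exact hwb n)
    (by
      intro i j hij
      rw [← smul_sub, sub_sub_sub_cancel_right, hsc, le_div_iff₀ hρ0]
      have h1 : R * t₀ / 6 ≤ ‖T (w i) - T (w j)‖ := by
        have : T (w i) - T (w j) = (R / 3 * t₀) • (e i - e j) := by
          rw [hTw, hTw]; module
        rw [this, norm_smul, Real.norm_of_nonneg (by positivity)]
        have := aux_sep' e he1 heb i j hij
        have : R / 3 * t₀ * (1 / 2) ≤ R / 3 * t₀ * ‖e i - e j‖ := by gcongr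
        linarith
      have h2 : 1 ≤ ‖w i - w j‖ := by
        by_contra! hcon
        linarith [hK _ (hwS i) _ (hwS j) hcon.le]
      have h3 := aux_L S T hLip 1 one_pos _ (hwS i) _ (hwS j) h2
      rw [← hLdef] at h3
      have h4 : C * ρ ≤ 2 * R := by
        have h5 : C * (1 / 2) * ρ ≤ C * (1 - η) * ρ := by gcongr; linarith
        have h6 : R / 3 * A ≤ R / 3 * (5 / 2) := by gcongr; linarith
        linarith
      have h7 : C * ρ * t₀ ≤ 2 * R * t₀ := by gcongr
      rw [div_mul_eq_mul_div, div_le_iff₀ (by positivity)]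
      nlinarith)
  rw [← smul_sub, sub_sub_sub_cancel_right, hsc, div_div, div_le_iff₀ (by positivity)] at hn
  have hδ1 : δ ≤ 1 := by
    by_contra! hcon
    have := norm_nonneg (x - w n)
    nlinarith [mul_pos hρ0 (sub_pos.2 hcon)]
  obtain ⟨z, ⟨hzb, hzS⟩, hTz⟩ := hc ρ hρd (w n) (hwS n) y (by
    have : y - T (w n) = (R / 3) • (u - t₀ • e n) := by
      rw [hTw, hTp, eq_add_of_sub_eq' hRu.symm]; module
    rw [this, norm_smul, Real.norm_of_nonneg (by positivity)]
    refine lt_of_le_of_lt ?_ hcρ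
    gcongr
    exact (he n).2)
  rw [mem_closedBall, dist_eq_norm] at hzb
  apply hyn
  refine ⟨z, ⟨?_, hzS⟩, hTz⟩
  rw [mem_closedBall, dist_eq_norm]
  have h1 : ‖z - x‖ ≤ ‖z - w n‖ + ‖x - w n‖ := by
    rw [norm_sub_rev x]; exact norm_sub_le_norm_sub_add_norm_sub _ _ _
  have h2 : ‖z - x‖ ≤ ρ * (3 - 2 * δ) := by linarith
  refine h2.trans ?_
  refine le_of_mul_le_mul_left ?_ hCpp0
  have hb0 : 0 ≤ 1 - 2 / 3 * δ := by linarith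
  calc C * (1 - η) * (ρ * (3 - 2 * δ)) = R * (A * (1 - 2/3*δ)) := by
        rw [← mul_assoc, hρC]; ring
    _ ≤ C * (1 + η) * r * (A * (1 - 2/3*δ)) := by gcongr
    _ = C * r * (A * (1 - 2/3*δ) * (1 + η)) := by ring
    _ ≤ C * r * (1 - η) := by gcongr
    _ = C * (1 - η) * r := by ring

end
end

section
/- Let (qₙ) be a sequence in [1,∞) with qₙ → ∞, and let Y = (∑_{n=1}^∞ ℓ_{qₙ})_{ℓ₂} be the ℓ₂-sum of the sequence spaces ℓ_{qₙ}. Suppose the Banach space X has an equivalent norm with property (β). Then there is no uniform quotient map from any subset of X onto Y that is Lipschitz for large distances. -/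
open Set Metric Filter Topology

noncomputable section

lemma aux_core {X E : Type*} [NormedAddCommGroup X] [NormedSpace ℝ X]
    [NormedAddCommGroup E] [NormedSpace ℝ E] (N : X → ℝ)
    (hNadd : ∀ x y, N (x + y) ≤ N x + N y)
    (hNsmul : ∀ (a : ℝ) (x : X), N (a • x) = |a| * N x)
    (T : X → E) (S : Set X) (L c0 δ κ : ℝ) (hL : 0 < L) (hc0 : 0 < c0)
    (hδ0 : 0 < δ) (hκ1 : 1 < κ) (hκ2 : κ ≤ 2) (hκ : κ ^ 2 * (1 - δ / 2) ≤ 1)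
    (hβ : ∀ x : X, N x ≤ 1 → ∀ xs : ℕ → X, (∀ n, N (xs n) ≤ 1) →
      (∀ m n, m ≠ n → c0 / (8 * L) ≤ N (xs m - xs n)) →
      ∃ n, N (x - xs n) / 2 ≤ 1 - δ)
    (hS : S.Nonempty) (hE : ∃ u : E, ‖u‖ = 1)
    (H1 : ∀ x ∈ S, ∀ x' ∈ S, ‖T x - T x'‖ ≤ 1 + L * N (x - x'))
    (H2 : ∀ r, 1 ≤ r → ∀ x ∈ S, ∀ y, ‖y - T x‖ ≤ c0 * r → ∃ x' ∈ S, N (x' - x) ≤ r ∧ T x' = y)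
    (H3 : ∀ z : E, ∃ e : ℕ → E, (∀ m n, m ≠ n → ‖z‖ / 4 ≤ ‖e m - e n‖) ∧
      (∀ n, ‖(1/4 : ℝ) • z + e n‖ ≤ κ * (‖z‖ / 4)) ∧
      (∀ n, ‖(1/2 : ℝ) • z - e n‖ ≤ κ * (‖z‖ / 2))) : False := by
  have hNneg : ∀ x y, N (x - y) = N (y - x) := by
    intro x y
    have := hNsmul (-1) (x - y)
    simp at this
    exact this.symm
  have hNtri : ∀ x y w, N (x - w) ≤ N (x - y) + N (y - w) := by
    intro x y w
    have := hNadd (x - y) (y - w)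
    simpa using this
  let A : Set ℝ := {c | ∃ d, 1 ≤ d ∧ ∀ r, d ≤ r → ∀ x ∈ S, ∀ y, ‖y - T x‖ ≤ c * r →
    ∃ x' ∈ S, N (x' - x) ≤ r ∧ T x' = y}
  have hc0A : c0 ∈ A := ⟨1, le_rfl, H2⟩
  have hAb : ∀ c ∈ A, c ≤ L + 1 := by
    rintro c ⟨d, hd1, hd⟩
    by_contra hc
    push Not at hc
    obtain ⟨x, hx⟩ := hS
    obtain ⟨u, hu⟩ := hE
    have hcp : 0 < c * d := by nlinarith
    obtain ⟨x', hx', hN, hT⟩ := hd d le_rfl x hx (T x + (c * d) • u) (by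
      rw [add_sub_cancel_left, norm_smul, hu, mul_one, Real.norm_of_nonneg hcp.le])
    have h := H1 x' hx' x hx
    rw [hT, add_sub_cancel_left, norm_smul, hu, mul_one, Real.norm_of_nonneg hcp.le] at h
    nlinarith
  obtain ⟨c, hcA, hcc0, hcκ⟩ : ∃ c ∈ A, c0 ≤ c ∧ κ * c ∉ A := by
    have hb : BddAbove A := ⟨L + 1, hAb⟩
    have hC : c0 ≤ sSup A := le_csSup hb hc0A
    have hlt : sSup A / κ < sSup A := div_lt_self (by linarith) hκ1
    obtain ⟨c1, hc1, hc1'⟩ := exists_lt_of_lt_csSup ⟨c0, hc0A⟩ hlt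
    have hk : ∀ c, sSup A / κ < c → κ * c ∉ A := by
      intro c hc hcA
      have := le_csSup hb hcA
      rw [div_lt_iff₀ (by linarith)] at hc
      linarith
    rcases le_total c0 c1 with h | h
    · exact ⟨c1, hc1, h, hk _ hc1'⟩
    · exact ⟨c0, hc0A, le_rfl, hk _ (by linarith)⟩
  have hcpos : 0 < c := by linarith
  obtain ⟨d, hd1, hd⟩ := hcA
  have : ∃ r, max (4 * d) (8 / c0) ≤ r ∧ ∃ x ∈ S, ∃ y, ‖y - T x‖ ≤ κ * c * r ∧
      ∀ x' ∈ S, T x' = y → r < N (x' - x) := by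
    by_contra hcon
    push Not at hcon
    apply hcκ
    refine ⟨max (4 * d) (8 / c0), le_max_of_le_left (by linarith), ?_⟩
    intro r hr x hx y hy
    obtain ⟨x', h1, h2, h3⟩ := hcon r hr x hx y hy
    exact ⟨x', h1, h3, h2⟩
  obtain ⟨r, hr, x, hx, y, hy, hno⟩ := this
  have hr4 : 4 * d ≤ r := le_trans (le_max_left _ _) hr
  have hr8 : 8 ≤ c0 * r := by
    have := le_trans (le_max_right _ _) hr
    rw [div_le_iff₀ hc0] at this
    linarith
  have hrpos : 0 < r := by linarith
  obtain ⟨e, he1, he2, he3⟩ := H3 (y - T x)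
  have hz : c * r < ‖y - T x‖ := by
    by_contra h
    push Not at h
    obtain ⟨x', h1, h2, h3⟩ := hd r (by linarith) x hx y h
    exact absurd (hno x' h1 h3) (by linarith)
  generalize hzdef : y - T x = z at *
  obtain ⟨ρ, hρ⟩ : ∃ ρ, ρ = κ ^ 2 * r / 4 := ⟨_, rfl⟩
  have hκsq : 1 ≤ κ ^ 2 := by nlinarith
  have hκsq4 : κ ^ 2 ≤ 4 := by nlinarith
  have hρd : d ≤ ρ := by nlinarith
  have hρpos : 0 < ρ := by linarith
  have hκz : κ * ‖z‖ ≤ c * (4 * ρ) := by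
    rw [hρ]
    have := mul_le_mul_of_nonneg_left hy (by linarith : 0 ≤ κ)
    nlinarith
  have hzz : ‖z‖ ≤ κ * ‖z‖ := by nlinarith [norm_nonneg z]
  obtain ⟨x1, hx1, hNx1, hTx1⟩ := hd ρ hρd x hx (T x + (1/4 : ℝ) • z) (by
    rw [add_sub_cancel_left, norm_smul]
    norm_num
    linarith)
  have hw : ∀ n, ∃ w ∈ S, N (w - x1) ≤ ρ ∧ T w = T x + (1/2 : ℝ) • z + e n := by
    intro n
    refine hd ρ hρd x1 hx1 _ ?_
    have h1 : T x + (1/2 : ℝ) • z + e n - T x1 = (1/4 : ℝ) • z + e n := by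
      rw [hTx1]; module
    rw [h1]
    linarith [he2 n]
  choose w hwS hwN hwT using hw
  have habs : |ρ⁻¹| = ρ⁻¹ := abs_of_pos (inv_pos.2 hρpos)
  obtain ⟨n, hn⟩ := hβ (ρ⁻¹ • (x - x1)) (by
      rw [hNsmul, habs, hNneg, inv_mul_le_iff₀ hρpos, mul_one]; exact hNx1)
    (fun n => ρ⁻¹ • (w n - x1)) (fun n => by
      rw [hNsmul, habs, inv_mul_le_iff₀ hρpos, mul_one]; exact hwN n) (by
      intro m n hmn
      have h0 : ρ⁻¹ • (w m - x1) - ρ⁻¹ • (w n - x1) = ρ⁻¹ • (w m - w n) := by module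
      show _ ≤ N (ρ⁻¹ • (w m - x1) - ρ⁻¹ • (w n - x1))
      rw [h0, hNsmul, habs, le_inv_mul_iff₀ hρpos]
      have h1 := H1 _ (hwS m) _ (hwS n)
      rw [hwT, hwT, add_sub_add_left_eq_sub] at h1
      have h2 := he1 m n hmn
      have h3 : c0 * r ≤ c * r := by nlinarith
      have h4 : ρ * c0 ≤ 8 * (L * N (w m - w n)) := by
        have : ρ ≤ r := by nlinarith
        nlinarith
      rw [mul_div_assoc', div_le_iff₀ (by positivity)]
      linarith)
  have h0 : ρ⁻¹ • (x - x1) - ρ⁻¹ • (w n - x1) = ρ⁻¹ • (x - w n) := by module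
  rw [h0, hNsmul, habs, div_le_iff₀ (by norm_num), inv_mul_le_iff₀ hρpos] at hn
  obtain ⟨v, hv, hvN, hvT⟩ := hd (2 * ρ) (by linarith) (w n) (hwS n) y (by
    have h1 : y - T (w n) = (1/2 : ℝ) • z - e n := by
      rw [hwT, ← hzdef]; module
    rw [h1]
    linarith [he3 n])
  have h5 := hno v hv hvT
  have h6 := hNtri v (w n) x
  rw [hNneg (w n) x] at h6
  have h7 : N (v - x) ≤ κ ^ 2 * (1 - δ / 2) * r := by
    have : κ ^ 2 * (1 - δ / 2) * r = 4 * ρ * (1 - δ / 2) := by rw [hρ]; ring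
    rw [this]
    linarith
  nlinarith

lemma aux_lp (p : ℝ) (hp : 1 ≤ p) [Fact (1 ≤ ENNReal.ofReal p)] (ε : ℝ) (hε : 0 ≤ ε) (M : ℝ)
    (f : lp (fun _ : ℕ => ℝ) (ENNReal.ofReal p)) (hf : ‖f‖ ≤ M) (n : ℕ) (s : ℝ)
    (hs : |s| ≤ M) (hn : |f n| ≤ ε * M) :
    ‖f + lp.single (ENNReal.ofReal p) n s‖ ≤ (2 : ℝ) ^ (1 / p) * (1 + ε) * M := by
  have hp0 : 0 < p := by linarith
  have htr : (ENNReal.ofReal p).toReal = p := ENNReal.toReal_ofReal hp0.le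
  have hp' : 0 < (ENNReal.ofReal p).toReal := by rw [htr]; exact hp0
  have hM : 0 ≤ M := le_trans (norm_nonneg _) hf
  have h1 := lp.hasSum_norm hp' f
  have h2 := lp.hasSum_norm hp' (f + lp.single (ENNReal.ofReal p) n s)
  rw [htr] at h1 h2
  have h3 := h1.update n (|f n + s| ^ p)
  have h4 : (fun i => ‖(f + lp.single (ENNReal.ofReal p) n s : lp (fun _ : ℕ => ℝ) (ENNReal.ofReal p)) i‖ ^ p)
      = Function.update (fun i => ‖f i‖ ^ p) n (|f n + s| ^ p) := by
    funext i
    by_cases h : i = n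
    · subst h
      simp
    · simp [h, Function.update_of_ne]
  rw [h4] at h2
  have h5 := h2.unique h3
  have h6 : |f n + s| ^ p ≤ ((1 + ε) * M) ^ p := by
    apply Real.rpow_le_rpow (abs_nonneg _) _ hp0.le
    linarith [abs_add_le (f n) s]
  have h7 : ‖f‖ ^ p ≤ ((1 + ε) * M) ^ p := by
    apply Real.rpow_le_rpow (norm_nonneg _) _ hp0.le
    nlinarith
  have h8 : 0 ≤ ‖f n‖ ^ p := by positivity
  have h9 : ((2 : ℝ) ^ (1 / p) * (1 + ε) * M) ^ p = 2 * ((1 + ε) * M) ^ p := by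
    rw [mul_assoc, Real.mul_rpow (by positivity) (by positivity), ← Real.rpow_mul (by norm_num)]
    rw [one_div_mul_cancel hp0.ne', Real.rpow_one]
  refine (Real.rpow_le_rpow_iff (norm_nonneg _) (by positivity) hp0).1 ?_
  rw [h9, h5]
  linarith

lemma aux_fork (p : ℝ) (hp : 1 ≤ p) [Fact (1 ≤ ENNReal.ofReal p)] (ε κ : ℝ) (hε : 0 < ε)
    (hκ : (2 : ℝ) ^ (1 / p) * (1 + ε) ≤ κ) (z : lp (fun _ : ℕ => ℝ) (ENNReal.ofReal p)) :
    ∃ e : ℕ → lp (fun _ : ℕ => ℝ) (ENNReal.ofReal p),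
      (∀ m n, m ≠ n → ‖z‖ / 4 ≤ ‖e m - e n‖) ∧
      (∀ n, ‖(1/4 : ℝ) • z + e n‖ ≤ κ * (‖z‖ / 4)) ∧
      (∀ n, ‖(1/2 : ℝ) • z - e n‖ ≤ κ * (‖z‖ / 2)) := by
  have hp0 : 0 < p := by linarith
  have htr : (ENNReal.ofReal p).toReal = p := ENNReal.toReal_ofReal hp0.le
  have hne : ENNReal.ofReal p ≠ 0 := by simpa using hp0
  by_cases hz : z = 0
  · subst hz
    exact ⟨fun _ => 0, by simp⟩
  have hzp : 0 < ‖z‖ := norm_pos_iff.2 hz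
  have hN : ∃ N0, ∀ n ≥ N0, |z n| ≤ ε * ‖z‖ := by
    have h1 := (lp.hasSum_norm (by rw [htr]; exact hp0) z).summable.tendsto_atTop_zero
    rw [htr] at h1
    have h2 := h1.eventually_lt_const (u := (ε * ‖z‖) ^ p) (by positivity)
    obtain ⟨N0, hN0⟩ := eventually_atTop.1 h2
    refine ⟨N0, fun n hn => ?_⟩
    exact ((Real.rpow_lt_rpow_iff (norm_nonneg _) (by positivity) hp0).1 (hN0 n hn)).le
  obtain ⟨N0, hN0⟩ := hN
  refine ⟨fun n => lp.single (ENNReal.ofReal p) (N0 + n) (‖z‖ / 4), ?_, ?_, ?_⟩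
  · intro m n hmn
    have h := lp.norm_apply_le_norm hne
      (lp.single (E := fun _ : ℕ => ℝ) (ENNReal.ofReal p) (N0 + m) (‖z‖ / 4)
        - lp.single (ENNReal.ofReal p) (N0 + n) (‖z‖ / 4)) (N0 + m)
    have hmn' : N0 + m ≠ N0 + n := by omega
    simpa [hmn, abs_of_pos, hzp] using h
  · intro n
    refine (aux_lp p hp ε hε.le (‖z‖ / 4) ((1/4 : ℝ) • z) ?_ (N0 + n) (‖z‖ / 4) ?_ ?_).trans ?_
    · rw [norm_smul]; norm_num; linarith
    · rw [abs_of_pos (by positivity)]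
    · have := hN0 (N0 + n) (by omega)
      rw [lp.coeFn_smul, Pi.smul_apply, smul_eq_mul, abs_mul]; norm_num; linarith
    · exact mul_le_mul_of_nonneg_right hκ (by positivity)
  · intro n
    rw [← norm_neg, neg_sub, sub_eq_neg_add]
    refine (aux_lp p hp ε hε.le (‖z‖ / 2) (-((1/2 : ℝ) • z)) ?_ (N0 + n) (‖z‖ / 4) ?_ ?_).trans ?_
    · rw [norm_neg, norm_smul]; norm_num; linarith
    · rw [abs_of_pos (by positivity)]; linarith
    · have := hN0 (N0 + n) (by omega)
      rw [lp.coeFn_neg, Pi.neg_apply, abs_neg, lp.coeFn_smul, Pi.smul_apply, smul_eq_mul, abs_mul]; norm_num; linarith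
    · exact mul_le_mul_of_nonneg_right hκ (by positivity)

/-- Corollary `cor2`: no uniform quotient map, Lipschitz for large
distances, from a subset of a space with an equivalent norm with property (β) onto
`(∑ₙ ℓ_{qₙ})_{ℓ₂}` when `qₙ → ∞`. -/
theorem stmt4 {X : Type*} [NormedAddCommGroup X] [NormedSpace ℝ X] [CompleteSpace X]
    (q : ℕ → ℝ) (hq1 : ∀ n, 1 ≤ q n) (hq : Tendsto q atTop atTop)
    [∀ n, Fact (1 ≤ ENNReal.ofReal (q n))]
    (hX : ∃ N : X → ℝ, IsEquivNorm N ∧ NormHasPropertyBeta N) :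
    ¬ ∃ (S : Set X) (T : X → lp (fun n => lp (fun _ : ℕ => ℝ) (ENNReal.ofReal (q n))) 2),
        T '' S = Set.univ ∧ UniformQuotientOn T S ∧ LipschitzLargeDist T S := by
  rintro ⟨S, T, hsurj, ⟨hUC, hCU⟩, hLip⟩
  obtain ⟨N, ⟨hNadd, hNsmul, cN, hcN, CN, hCN, hNeq⟩, a, ha1, ha2, hβ⟩ := hX
  have hN0 : N 0 = 0 := by simpa using hNsmul 0 0
  have hNnn : ∀ x, 0 ≤ N x := fun x => le_trans (by positivity) (hNeq x).1
  -- Lipschitz estimate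
  obtain ⟨L, hL, H1⟩ : ∃ L > 0, ∀ x ∈ S, ∀ x' ∈ S, ‖T x - T x'‖ ≤ 1 + L * N (x - x') := by
    obtain ⟨δ1, hδ1, h1⟩ := hUC 1 one_pos
    obtain ⟨B, hB⟩ := hLip δ1 hδ1
    refine ⟨|B| / cN + 1, by positivity, fun x hx x' hx' => ?_⟩
    have hnn := hNnn (x - x')
    rcases le_total ‖x - x'‖ δ1 with h | h
    · have := h1 x hx x' hx' h
      have h3 : 0 ≤ (|B| / cN + 1) * N (x - x') := by positivity
      linarith
    · have h2 : ‖T x - T x'‖ / ‖x - x'‖ ≤ B := hB ⟨x, hx, x', hx', h, rfl⟩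
      rw [div_le_iff₀ (by linarith)] at h2
      have h3 : B * ‖x - x'‖ ≤ |B| * ‖x - x'‖ :=
        mul_le_mul_of_nonneg_right (le_abs_self B) (norm_nonneg _)
      have h4 : |B| * ‖x - x'‖ ≤ |B| / cN * N (x - x') := by
        rw [div_mul_eq_mul_div, le_div_iff₀ hcN, mul_assoc]
        refine mul_le_mul_of_nonneg_left ?_ (abs_nonneg B)
        linarith [(hNeq (x - x')).1]
      nlinarith
  -- co-Lipschitz estimate
  obtain ⟨c0, hc0, H2⟩ : ∃ c0 > 0, ∀ r, 1 ≤ r → ∀ x ∈ S, ∀ y, ‖y - T x‖ ≤ c0 * r →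
      ∃ x' ∈ S, N (x' - x) ≤ r ∧ T x' = y := by
    obtain ⟨δ, hδ, h1⟩ := hCU (1 / CN) (by positivity)
    have step : ∀ x ∈ S, ∀ y, ‖y - T x‖ ≤ δ → ∃ x' ∈ S, N (x' - x) ≤ 1 ∧ T x' = y := by
      intro x hx y hy
      obtain ⟨x', ⟨hx'b, hx'S⟩, hT⟩ := h1 x hx (mem_closedBall_iff_norm.2 hy)
      refine ⟨x', hx'S, ?_, hT⟩
      rw [mem_closedBall_iff_norm, le_div_iff₀ hCN] at hx'b
      linarith [(hNeq (x' - x)).2]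
    have chain : ∀ k : ℕ, ∀ x ∈ S, ∀ y, ‖y - T x‖ ≤ k * δ →
        ∃ x' ∈ S, N (x' - x) ≤ k ∧ T x' = y := by
      intro k
      induction k with
      | zero =>
        intro x hx y hy
        simp only [Nat.cast_zero, zero_mul, norm_le_zero_iff, sub_eq_zero] at hy
        exact ⟨x, hx, by simp [hN0], hy.symm⟩
      | succ k ih =>
        intro x hx y hy
        have hk : (0 : ℝ) < (k : ℝ) + 1 := by positivity
        push_cast at hy ⊢
        obtain ⟨x1, hx1, hN1, hT1⟩ := ih x hx (T x + ((k : ℝ) / (k + 1)) • (y - T x)) (by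
          rw [add_sub_cancel_left, norm_smul, Real.norm_of_nonneg (by positivity),
            div_mul_eq_mul_div, div_le_iff₀ hk, mul_assoc, mul_comm δ]
          exact mul_le_mul_of_nonneg_left hy (by positivity))
        obtain ⟨x2, hx2, hN2, hT2⟩ := step x1 hx1 y (by
          have : y - T x1 = ((1 : ℝ) / (k + 1)) • (y - T x) := by
            have h3 : (1 : ℝ) / (k + 1) = 1 - k / (k + 1) := by field_simp; ring
            rw [hT1, h3]; module
          rw [this, norm_smul, Real.norm_of_nonneg (by positivity),
            div_mul_eq_mul_div, div_le_iff₀ hk]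
          linarith)
        refine ⟨x2, hx2, ?_, hT2⟩
        have := hNadd (x2 - x1) (x1 - x)
        rw [sub_add_sub_cancel] at this
        linarith
    refine ⟨δ / 2, by positivity, fun r hr x hx y hy => ?_⟩
    have hf1 := Nat.floor_le (by linarith : 0 ≤ r)
    have hf2 := Nat.lt_floor_add_one r
    have hf3 : (1 : ℝ) ≤ (⌊r⌋₊ : ℝ) := by
      exact_mod_cast (Nat.one_le_floor_iff r).2 hr
    obtain ⟨x', h1, h2, h3⟩ := chain ⌊r⌋₊ x hx y (by nlinarith)
    exact ⟨x', h1, by linarith, h3⟩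
  obtain ⟨δ, hδ, hβδ⟩ := hβ (min (c0 / (8 * L)) 1) (lt_min (by positivity) one_pos)
    ((min_le_right _ _).trans ha1)
  obtain ⟨η, hη⟩ : ∃ η, η = min δ 1 := ⟨_, rfl⟩
  have hη0 : 0 < η := by rw [hη]; exact lt_min hδ one_pos
  have hη1 : η ≤ 1 := by rw [hη]; exact min_le_right _ _
  have hηδ : η ≤ δ := by rw [hη]; exact min_le_left _ _
  have hn : ∃ n, (2 : ℝ) ^ (1 / q n) * (1 + η / 16) ≤ 1 + η / 8 := by
    have h1 : Tendsto (fun n => (2 : ℝ) ^ (1 / q n) * (1 + η / 16)) atTop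
        (𝓝 ((2 : ℝ) ^ (0 : ℝ) * (1 + η / 16))) := by
      refine Tendsto.mul_const _ ?_
      refine (Real.continuous_const_rpow (by norm_num : (2 : ℝ) ≠ 0)).continuousAt.tendsto.comp ?_
      exact tendsto_const_nhds.div_atTop hq
    have h2 := h1.eventually_lt_const (u := 1 + η / 8) (by rw [Real.rpow_zero]; linarith)
    obtain ⟨n, hn⟩ := h2.exists
    exact ⟨n, hn.le⟩
  obtain ⟨n, hn⟩ := hn
  let J : lp (fun _ : ℕ => ℝ) (ENNReal.ofReal (q n)) →
    lp (fun n => lp (fun _ : ℕ => ℝ) (ENNReal.ofReal (q n))) 2 := fun y => lp.single 2 n y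
  have hJsub : ∀ y y', ‖J y - J y'‖ = ‖y - y'‖ := by
    intro y y'
    have : J y - J y' = J (y - y') := (lp.single_sub (E := fun n => lp (fun _ : ℕ => ℝ) (ENNReal.ofReal (q n))) 2 n y y').symm
    rw [this]
    exact lp.norm_single (E := fun n => lp (fun _ : ℕ => ℝ) (ENNReal.ofReal (q n))) (by norm_num) n (y - y')
  have hJn : ∀ y, (J y) n = y := fun y => lp.single_apply_self _ _ _
  refine aux_core N hNadd hNsmul (fun x => (T x) n) {x | x ∈ S ∧ ∃ y, T x = J y} L c0 η (1 + η / 8)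
    hL hc0 hη0 (by linarith) (by linarith) (by nlinarith [mul_pos hη0 hη0, mul_pos (mul_pos hη0 hη0) hη0]) ?_ ?_ ?_ ?_ ?_ ?_
  · intro x hx xs hxs hsep
    obtain ⟨m, hm⟩ := hβδ x hx xs hxs (fun i j hij => (min_le_left _ _).trans (hsep i j hij))
    exact ⟨m, by linarith⟩
  · have h0 : J 0 ∈ T '' S := by rw [hsurj]; trivial
    obtain ⟨x, hx, hT⟩ := h0
    exact ⟨x, hx, 0, hT⟩
  · refine ⟨lp.single (ENNReal.ofReal (q n)) 0 (1 : ℝ), ?_⟩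
    rw [lp.norm_single (by have := hq1 n; simp; linarith)]
    simp
  · rintro x ⟨hx, y, hy⟩ x' ⟨hx', y', hy'⟩
    have := H1 x hx x' hx'
    rw [hy, hy', hJsub] at this
    show ‖(T x) n - (T x') n‖ ≤ _
    rw [hy, hy', hJn, hJn]
    exact this
  · rintro r hr x ⟨hx, y0, hy0⟩ y hy
    change ‖y - (T x) n‖ ≤ _ at hy
    rw [hy0, hJn] at hy
    obtain ⟨x', h1, h2, h3⟩ := H2 r hr x hx (J y) (by rw [hy0, hJsub]; exact hy)
    refine ⟨x', ⟨h1, y, h3⟩, h2, ?_⟩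
    show (T x') n = y
    rw [h3, hJn]
  · exact aux_fork (q n) (hq1 n) (η / 16) (1 + η / 8) (by linarith) hn


end
end

section
/- Let (pₙ) be a sequence in (1,∞) decreasing to 1 as n → ∞, and let Y = (∑_{n≥1} ℓ_{pₙ})_{ℓ₂} be the ℓ₂-sum of the sequence spaces ℓ_{pₙ}. Suppose the Banach space X is linearly isomorphic to a Banach space with property (β). Then there is no uniform quotient map that is Lipschitz for large distances from any subset of X onto Y. -/
open Set Metric Filter Topology

noncomputable section

/-- A Banach space with property (β) of Rolewicz. -/
structure BanachBetaSpace where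
  carrier : Type
  [nacg : NormedAddCommGroup carrier]
  [nsp : NormedSpace ℝ carrier]
  [complete : CompleteSpace carrier]
  beta : PropertyBeta carrier

attribute [instance] BanachBetaSpace.nacg BanachBetaSpace.nsp BanachBetaSpace.complete


theorem core_aux {X W Y : Type*} [NormedAddCommGroup W] [NormedSpace ℝ W]
    [NormedAddCommGroup Y] [NormedSpace ℝ Y] (hβ : PropertyBeta W)
    (S : Set X) (hS : S.Nonempty) (f : X → W) (T : X → Y) (d c : ℝ) (hd : 0 < d) (hc : 0 < c)
    (lift : ∀ x ∈ S, ∀ y, ‖y - T x‖ ≤ d → ∃ x' ∈ S, T x' = y ∧ ‖f x - f x'‖ ≤ 1)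
    (low : ∀ x ∈ S, ∀ x' ∈ S, d / 4 < ‖T x - T x'‖ → c * ‖T x - T x'‖ ≤ ‖f x - f x'‖)
    (vec : ∀ M : ℕ, ∃ v : ℕ → Y, (∀ i, ‖v i‖ ≤ 1) ∧ ∀ A B : Finset ℕ, Disjoint A B →
      A.card + B.card ≤ M →
      ((A.card : ℝ) + B.card) / 2 ≤ ‖∑ i ∈ A, v i - ∑ i ∈ B, v i‖) : False := by
  obtain ⟨a, ha1, -, hβ⟩ := hβ
  have hcd : 0 < c * d := by positivity
  obtain ⟨b0, hb0, hb⟩ := hβ (min 1 (c * d)) (lt_min one_pos hcd) ((min_le_left _ _).trans ha1)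
  set b := min b0 (1/2) with hbdef
  have hbpos : 0 < b := lt_min hb0 (by norm_num)
  have hbhalf : b ≤ 1/2 := min_le_right _ _
  have hbb0 : b ≤ b0 := min_le_left _ _
  obtain ⟨J, hJ⟩ := exists_pow_lt_of_lt_one (show 0 < c * d / 2 by positivity)
    (show 1 - b < 1 by linarith)
  obtain ⟨v, hv1, hv⟩ := vec (2 ^ (J + 1))
  have P : ∀ j, j ≤ J → ∀ x ∈ S, ∀ F : Finset ℕ, ∃ x' ∈ S, ∃ G : Finset ℕ,
      Disjoint F G ∧ G.card = 2 ^ j ∧ T x' = T x + d • ∑ i ∈ G, v i ∧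
      ‖f x - f x'‖ ≤ (2 * (1 - b)) ^ j := by
    intro j
    induction j with
    | zero =>
      intro _ x hx F
      obtain ⟨i, hi⟩ := Infinite.exists_notMem_finset F
      obtain ⟨x', hx', h1, h2⟩ := lift x hx (T x + d • v i) (by
        rw [add_sub_cancel_left, norm_smul, Real.norm_of_nonneg hd.le]
        nlinarith [hv1 i])
      exact ⟨x', hx', {i}, by simpa using hi, by simp, by simpa using h1, by simpa using h2⟩
    | succ j ih =>
      intro hj x hx F
      have ih := ih (by omega)
      obtain ⟨m, hm, G0, hG0, hG0c, hTm, hxm⟩ := ih x hx F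
      choose w hwS G hGd hGc hTw hmw using fun F' => ih m hm F'
      let Fs : ℕ → Finset ℕ := fun n => Nat.rec (F ∪ G0) (fun _ F' => F' ∪ G F') n
      have hFs : ∀ n, Fs (n + 1) = Fs n ∪ G (Fs n) := fun n => rfl
      have hmono : Monotone Fs := monotone_nat_of_le_succ fun n => by
        rw [hFs]; exact Finset.subset_union_left
      have hdis : ∀ n k, n < k → Disjoint (G (Fs n)) (G (Fs k)) := by
        intro n k hnk
        refine Finset.disjoint_of_subset_left ?_ (hGd (Fs k))
        refine Finset.Subset.trans ?_ (hmono (Nat.succ_le_of_lt hnk))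
        rw [Nat.succ_eq_add_one, hFs]; exact Finset.subset_union_right
      have hdis' : ∀ n k, n ≠ k → Disjoint (G (Fs n)) (G (Fs k)) := by
        intro n k hnk
        rcases lt_or_gt_of_ne hnk with h | h
        · exact hdis n k h
        · exact (hdis k n h).symm
      set r := (2 * (1 - b)) ^ j with hr
      have hrpos : 0 < r := by rw [hr]; apply pow_pos; linarith
      have hr2 : r ≤ 2 ^ j := by
        rw [hr]; apply pow_le_pow_left₀ <;> linarith
      have h2j : (1:ℝ) ≤ 2 ^ j := one_le_pow₀ (by norm_num)
      have hsep : ∀ n k, n ≠ k → min 1 (c * d) * r ≤ ‖f (w (Fs n)) - f (w (Fs k))‖ := by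
        intro n k hnk
        have h1 := hv _ _ (hdis' n k hnk) (by
          rw [hGc, hGc, ← two_mul, ← pow_succ']
          exact Nat.pow_le_pow_right (by norm_num) (by omega))
        rw [hGc, hGc] at h1
        push_cast at h1
        have h2 : T (w (Fs n)) - T (w (Fs k)) =
            d • (∑ i ∈ G (Fs n), v i - ∑ i ∈ G (Fs k), v i) := by
          rw [hTw, hTw, smul_sub]; abel
        have h3 : d * 2 ^ j ≤ ‖T (w (Fs n)) - T (w (Fs k))‖ := by
          rw [h2, norm_smul, Real.norm_of_nonneg hd.le]
          apply mul_le_mul_of_nonneg_left _ hd.le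
          linarith
        have h4 := low _ (hwS (Fs n)) _ (hwS (Fs k)) (by nlinarith)
        calc min 1 (c * d) * r ≤ (c * d) * 2 ^ j :=
              mul_le_mul (min_le_right _ _) hr2 hrpos.le hcd.le
          _ = c * (d * 2 ^ j) := by ring
          _ ≤ c * ‖T (w (Fs n)) - T (w (Fs k))‖ := by gcongr
          _ ≤ _ := h4
      have hnr : ∀ z : W, ‖r⁻¹ • z‖ = ‖z‖ / r := by
        intro z
        rw [norm_smul, Real.norm_of_nonneg (inv_nonneg.2 hrpos.le)]
        field_simp
      obtain ⟨n, hn⟩ := hb (r⁻¹ • (f x - f m)) (by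
          rw [mem_closedBall_zero_iff, hnr, div_le_one hrpos]; exact hxm)
        (fun n => r⁻¹ • (f (w (Fs n)) - f m)) (fun n => by
          rw [mem_closedBall_zero_iff, hnr, div_le_one hrpos, norm_sub_rev]; exact hmw _)
        (fun n k hnk => by
          rw [← smul_sub, hnr, le_div_iff₀ hrpos, sub_sub_sub_cancel_right]
          exact hsep n k hnk)
      rw [← smul_sub, hnr, sub_sub_sub_cancel_right] at hn
      have hsub : F ∪ G0 ⊆ Fs n := hmono (Nat.zero_le n)
      have hd2 : Disjoint (F ∪ G0) (G (Fs n)) := Finset.disjoint_of_subset_left hsub (hGd _)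
      rw [Finset.disjoint_union_left] at hd2
      refine ⟨w (Fs n), hwS _, G0 ∪ G (Fs n), ?_, ?_, ?_, ?_⟩
      · rw [Finset.disjoint_union_right]; exact ⟨hG0, hd2.1⟩
      · rw [Finset.card_union_of_disjoint hd2.2, hG0c, hGc]; ring
      · rw [hTw, hTm, Finset.sum_union hd2.2, smul_add, add_assoc]
      · rw [pow_succ, ← hr]
        have : ‖f x - f (w (Fs n))‖ / r ≤ 2 * (1 - b) := by linarith
        rw [div_le_iff₀ hrpos] at this
        linarith
  obtain ⟨x, hx⟩ := hS
  obtain ⟨x', hx', G, -, hGc, hT, hf⟩ := P J le_rfl x hx ∅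
  have h1 := hv G ∅ (Finset.disjoint_empty_right _) (by
    rw [hGc, Finset.card_empty, pow_succ]; omega)
  simp only [hGc, Finset.card_empty, Finset.sum_empty, sub_zero] at h1
  push_cast at h1
  have h2J : (1:ℝ) ≤ 2 ^ J := one_le_pow₀ (by norm_num)
  have h3 : d * (2 ^ J / 2) ≤ ‖T x - T x'‖ := by
    rw [hT, sub_add_cancel_left, norm_neg, norm_smul, Real.norm_of_nonneg hd.le]
    apply mul_le_mul_of_nonneg_left _ hd.le
    linarith
  have h4 := low x hx x' hx' (by nlinarith)
  have h5 : c * (d * (2 ^ J / 2)) ≤ (2 * (1 - b)) ^ J :=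
    (mul_le_mul_of_nonneg_left h3 hc.le).trans (h4.trans hf)
  rw [mul_pow] at h5
  have h6 : (0:ℝ) < 2 ^ J := by positivity
  nlinarith

theorem vec_aux (p : ℕ → ℝ) (hp1 : ∀ n, 1 < p n) (hlim : Tendsto p atTop (𝓝 1))
    [∀ n, Fact (1 ≤ ENNReal.ofReal (p n))] (M : ℕ) :
    ∃ v : ℕ → lp (fun n => lp (fun _ : ℕ => ℝ) (ENNReal.ofReal (p n))) 2,
      (∀ i, ‖v i‖ ≤ 1) ∧ ∀ A B : Finset ℕ, Disjoint A B → A.card + B.card ≤ M →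
      ((A.card : ℝ) + B.card) / 2 ≤ ‖∑ i ∈ A, v i - ∑ i ∈ B, v i‖ := by
  have hev : ∀ᶠ k in atTop, ∀ n ∈ Finset.Icc 1 M, ((n : ℝ) / 2) ^ (p k) < n := by
    rw [Filter.eventually_all_finset]
    intro n hn
    have hn1 : 1 ≤ n := (Finset.mem_Icc.1 hn).1
    have hn0 : (0:ℝ) < n := by exact_mod_cast hn1
    have h : Tendsto (fun k => ((n : ℝ) / 2) ^ (p k)) atTop (𝓝 (((n : ℝ) / 2) ^ (1:ℝ))) :=
      tendsto_const_nhds.rpow hlim (Or.inl (by positivity))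
    rw [Real.rpow_one] at h
    exact h.eventually_lt_const (by linarith)
  obtain ⟨k, hk⟩ := hev.exists
  have hpk : 0 < p k := by linarith [hp1 k]
  have hpR : (ENNReal.ofReal (p k)).toReal = p k := ENNReal.toReal_ofReal hpk.le
  have hpE : 0 < ENNReal.ofReal (p k) := by simpa using hpk
  let u : ℕ → lp (fun _ : ℕ => ℝ) (ENNReal.ofReal (p k)) := fun i => lp.single _ i 1
  let v : ℕ → lp (fun n => lp (fun _ : ℕ => ℝ) (ENNReal.ofReal (p n))) 2 :=
    fun i => lp.single 2 k (u i)
  refine ⟨v, ?_, ?_⟩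
  · intro i
    have : ‖v i‖ = 1 := by
      simp only [v, u]
      rw [lp.norm_single (by norm_num), lp.norm_single hpE, norm_one]
    exact this.le
  · intro A B hAB hM
    have hsum : ∑ i ∈ A, v i - ∑ i ∈ B, v i
        = lp.single 2 k (∑ i ∈ A, u i - ∑ i ∈ B, u i) := by
      have := (lp.singleAddMonoidHom (E := fun n => lp (fun _ : ℕ => ℝ) (ENNReal.ofReal (p n))) 2 k)
      rw [← lp.singleAddMonoidHom_apply, map_sub, map_sum, map_sum]
      rfl
    rw [hsum, lp.norm_single (by norm_num)]
    rcases Nat.eq_zero_or_pos (A.card + B.card) with h0 | hpos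
    · have : ((A.card : ℝ) + B.card) = 0 := by exact_mod_cast h0
      rw [this]; simp
    have hsgn : ∑ i ∈ A, u i - ∑ i ∈ B, u i
        = ∑ i ∈ A ∪ B, lp.single (E := fun _ : ℕ => ℝ) (ENNReal.ofReal (p k)) i
            ((fun i => if i ∈ A then (1:ℝ) else -1) i) := by
      rw [Finset.sum_union hAB, sub_eq_add_neg, ← Finset.sum_neg_distrib]
      congr 1
      · refine Finset.sum_congr rfl fun i hi => ?_
        simp [hi, u]
      · refine Finset.sum_congr rfl fun i hi => ?_
        have : i ∉ A := fun h => (Finset.disjoint_left.1 hAB h) hi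
        simp [this, u]
    have hnorm : ‖∑ i ∈ A, u i - ∑ i ∈ B, u i‖ ^ p k = (A.card : ℝ) + B.card := by
      have := lp.norm_sum_single (E := fun _ : ℕ => ℝ) (p := ENNReal.ofReal (p k))
        (by rw [hpR]; exact hpk) (fun i => if i ∈ A then (1:ℝ) else -1) (A ∪ B)
      rw [← hsgn, hpR] at this
      rw [this]
      have h1 : ∀ i ∈ A ∪ B, ‖(if i ∈ A then (1:ℝ) else -1)‖ ^ p k = 1 := by
        intro i _; split_ifs <;> simp
      rw [Finset.sum_congr rfl h1, Finset.sum_const, Finset.card_union_of_disjoint hAB]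
      simp
    have := hk (A.card + B.card) (Finset.mem_Icc.2 ⟨hpos, hM⟩)
    push_cast at this
    rw [← Real.rpow_le_rpow_iff (by positivity) (norm_nonneg _) hpk, hnorm]
    exact this.le

/-- no uniform quotient map, Lipschitz for large distances, from a
subset of a space isomorphic to a Banach space with property (β) onto
`(∑ₙ ℓ_{pₙ})_{ℓ₂}` with `pₙ ↓ 1`. -/
theorem stmt5 {X : Type*} [NormedAddCommGroup X] [NormedSpace ℝ X] [CompleteSpace X]
    (p : ℕ → ℝ) (hp1 : ∀ n, 1 < p n) (hmono : Antitone p) (hlim : Tendsto p atTop (𝓝 1))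
    [∀ n, Fact (1 ≤ ENNReal.ofReal (p n))]
    (hX : ∃ W : BanachBetaSpace, Nonempty (X ≃L[ℝ] W.carrier)) :
    ¬ ∃ (S : Set X) (T : X → lp (fun n => lp (fun _ : ℕ => ℝ) (ENNReal.ofReal (p n))) 2),
        T '' S = Set.univ ∧ UniformQuotientOn T S ∧ LipschitzLargeDist T S := by
  rintro ⟨S, T, hsurj, ⟨huc, hco⟩, hL⟩
  obtain ⟨W, ⟨e⟩⟩ := hX
  have hS : S.Nonempty := by
    rw [Set.nonempty_iff_ne_empty]
    rintro rfl
    rw [Set.image_empty] at hsurj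
    exact Set.empty_ne_univ hsurj
  set K := ‖(e : X →L[ℝ] W.carrier)‖ with hK
  set K' := ‖(e.symm : W.carrier →L[ℝ] X)‖ with hK'
  have hK0 : 0 ≤ K := norm_nonneg _
  have hK'0 : 0 ≤ K' := norm_nonneg _
  have heK : ∀ x, ‖e x‖ ≤ K * ‖x‖ := fun x => (e : X →L[ℝ] W.carrier).le_opNorm x
  have heK' : ∀ x, ‖x‖ ≤ K' * ‖e x‖ := fun x => by
    simpa using (e.symm : W.carrier →L[ℝ] X).le_opNorm (e x)
  obtain ⟨d, hd, hlift⟩ := hco (1 / (K + 1)) (by positivity)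
  obtain ⟨η, hη, huc⟩ := huc (d / 4) (by positivity)
  obtain ⟨L, hL⟩ := hL η hη
  set L' := max L 1
  have hL1 : 1 ≤ L' := le_max_right _ _
  refine core_aux W.beta S hS e T d (1 / (L' * (K' + 1))) hd (by positivity) ?_ ?_
    (vec_aux p hp1 hlim)
  · intro x hx y hy
    obtain ⟨x', ⟨h1, h2⟩, h3⟩ := hlift x hx (mem_closedBall_iff_norm.2 hy)
    refine ⟨x', h2, h3, ?_⟩
    rw [mem_closedBall_iff_norm, norm_sub_rev] at h1
    rw [← map_sub]
    refine (heK _).trans ?_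
    calc K * ‖x - x'‖ ≤ (K + 1) * (1 / (K + 1)) := by gcongr; linarith
      _ = 1 := by field_simp
  · intro x hx x' hx' h
    have hηx : η < ‖x - x'‖ := by
      by_contra hcon
      exact absurd (huc x hx x' hx' (not_lt.1 hcon)) (not_le.2 h)
    have h1 : ‖T x - T x'‖ / ‖x - x'‖ ≤ L := hL ⟨x, hx, x', hx', hηx.le, rfl⟩
    rw [div_le_iff₀ (hη.trans hηx)] at h1
    have h2 : ‖T x - T x'‖ ≤ L' * ‖x - x'‖ :=
      h1.trans (by gcongr; exact le_max_left _ _)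
    have h3 := heK' (x - x')
    rw [map_sub] at h3
    rw [one_div, inv_mul_le_iff₀ (by positivity), mul_assoc]
    refine h2.trans ?_
    gcongr
    nlinarith [norm_nonneg (e x - e x')]

end
end

section
/- Let (pₙ) be a sequence in (1,∞) decreasing to 1 as n → ∞, and let Y = (∑_{n≥1} L_{pₙ}[0,1])_{ℓ₂} be the ℓ₂-sum of the Lebesgue spaces L_{pₙ}[0,1]. Suppose the Banach space X has property (β). Then there is no uniform quotient map that is Lipschitz for large distances from any subset of X onto Y. -/
open Set Metric Filter Topology

noncomputable section

theorem aux_core_s6 {X Y : Type*} [NormedAddCommGroup X] [NormedSpace ℝ X]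
    [NormedAddCommGroup Y] [NormedSpace ℝ Y] (hX : PropertyBeta X) (S : Set X) (T : X → Y)
    (hS : S.Nonempty) (hU : UniformQuotientOn T S) (hL : LipschitzLargeDist T S)
    (hY : ∀ N : ℕ, ∃ e : ℕ → Y, (∀ i, ‖e i‖ ≤ 1) ∧ ∀ (A : Finset ℕ) (σ : ℕ → ℝ),
      (∀ i, |σ i| = 1) → A.card ≤ 2 ^ (N + 1) → (A.card : ℝ) / 2 ≤ ‖∑ i ∈ A, σ i • e i‖) :
    False := by
  obtain ⟨hU1, hU2⟩ := hU
  obtain ⟨d, hd, hco⟩ := hU2 1 one_pos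
  obtain ⟨η, hη, hun⟩ := hU1 (d / 4) (by positivity)
  obtain ⟨L0, hL0⟩ := hL η hη
  set L : ℝ := max L0 1 with hLdef
  have hLpos : 0 < L := lt_of_lt_of_le one_pos (le_max_right _ _)
  have hlip : ∀ x ∈ S, ∀ x' ∈ S, d / 2 ≤ ‖T x - T x'‖ → ‖T x - T x'‖ ≤ L * ‖x - x'‖ := by
    intro x hx x' hx' h
    have h1 : η < ‖x - x'‖ := by
      by_contra hc
      have := hun x hx x' hx' (not_lt.1 hc)
      linarith
    have h2 : ‖T x - T x'‖ / ‖x - x'‖ ≤ L :=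
      le_trans (hL0 ⟨x, hx, x', hx', h1.le, rfl⟩) (le_max_left _ _)
    rwa [div_le_iff₀ (by linarith)] at h2
  obtain ⟨a, ha1, _, hβ⟩ := hX
  obtain ⟨β0, hβ0, hβ1⟩ := hβ (min (d / L) 1) (by positivity) (le_trans (min_le_right _ _) ha1)
  set q : ℝ := 1 - min β0 (1 / 2) with hq
  have hm0 : 0 < min β0 (1 / 2) := by positivity
  have hm1 : min β0 (1 / 2) ≤ 1 / 2 := min_le_right _ _
  have hm2 : min β0 (1 / 2) ≤ β0 := min_le_left _ _
  have hq0 : 0 < q := by linarith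
  have hq1 : q < 1 := by linarith
  obtain ⟨K, hK⟩ := exists_pow_lt_of_lt_one (show 0 < d / (2 * L) by positivity) hq1
  obtain ⟨e, he1, he2⟩ := hY K
  have key : ∀ k, k ≤ K → ∀ x ∈ S, ∀ φ : ℕ → ℕ, Function.Injective φ →
      ∃ A : Finset ℕ, A.card = 2 ^ k ∧ (∀ i ∈ A, i ∈ Set.range φ) ∧ ∃ x' ∈ S,
        T x' = T x + d • ∑ i ∈ A, e i ∧ ‖x - x'‖ ≤ (2 * q) ^ k := by
    intro k
    induction k with
    | zero =>
      intro _ x hx φ _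
      obtain ⟨x', ⟨hx'1, hx'2⟩, hx'3⟩ := hco x hx
        (show T x + d • e (φ 0) ∈ closedBall (T x) d by
          simp only [mem_closedBall, dist_eq_norm, add_sub_cancel_left, norm_smul,
            Real.norm_eq_abs, abs_of_pos hd]
          nlinarith [he1 (φ 0)])
      refine ⟨{φ 0}, by simp, by simp, x', hx'2, by simpa using hx'3, ?_⟩
      rw [← dist_eq_norm, dist_comm]
      simpa using hx'1
    | succ k ih =>
      intro hk x hx φ hφ
      have hk' : k ≤ K := by omega
      have hinj : ∀ m, Function.Injective (fun i => φ (Nat.pair m i)) := by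
        intro m i j hij
        have := hφ hij
        simpa using this
      obtain ⟨A1, hA1, hA1r, x1, hx1, hT1, hn1⟩ := ih hk' x hx _ (hinj 0)
      choose A hAc hAr z hz hTz hnz using fun m : ℕ => ih hk' x1 hx1 _ (hinj (m + 1))
      have hdisj : ∀ m n, m ≠ n → Disjoint (A m) (A n) := by
        intro m n hmn
        rw [Finset.disjoint_left]
        intro i hi hj
        obtain ⟨u, hu⟩ := hAr m i hi
        obtain ⟨v, hv⟩ := hAr n i hj
        have := hφ (hu.trans hv.symm)
        simp at this
        exact hmn this.1
      have hdisj1 : ∀ m, Disjoint A1 (A m) := by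
        intro m
        rw [Finset.disjoint_left]
        intro i hi hj
        obtain ⟨u, hu⟩ := hA1r i hi
        obtain ⟨v, hv⟩ := hAr m i hj
        have := hφ (hu.trans hv.symm)
        simp at this
      set c : ℝ := (2 * q) ^ k with hc
      have hcpos : 0 < c := by positivity
      have hpow1 : (1 : ℝ) ≤ 2 ^ k := one_le_pow₀ (by norm_num)
      have hsep : ∀ m n, m ≠ n → d / L ≤ ‖c⁻¹ • (z m - x1) - c⁻¹ • (z n - x1)‖ := by
        intro m n hmn
        have hS1 : ((2 : ℝ) ^ k) ≤ ‖∑ i ∈ A m, e i - ∑ i ∈ A n, e i‖ := by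
          have h := he2 (A m ∪ A n) (fun i => if i ∈ A m then 1 else -1)
            (by intro i; split_ifs <;> simp)
            (by
              rw [Finset.card_union_of_disjoint (hdisj m n hmn), hAc, hAc, ← two_mul, ← pow_succ']
              exact Nat.pow_le_pow_right (by norm_num) (by omega))
          rw [Finset.card_union_of_disjoint (hdisj m n hmn), hAc, hAc,
            Finset.sum_union (hdisj m n hmn)] at h
          have e1 : ∑ i ∈ A m, (if i ∈ A m then (1 : ℝ) else -1) • e i = ∑ i ∈ A m, e i :=
            Finset.sum_congr rfl fun i hi => by simp [hi]
          have e2 : ∑ i ∈ A n, (if i ∈ A m then (1 : ℝ) else -1) • e i = - ∑ i ∈ A n, e i := by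
            rw [← Finset.sum_neg_distrib]
            exact Finset.sum_congr rfl fun i hi => by
              simp [Finset.disjoint_right.1 (hdisj m n hmn) hi]
          rw [e1, e2, ← sub_eq_add_neg] at h
          push_cast at h
          linarith
        have hTd : T (z m) - T (z n) = d • (∑ i ∈ A m, e i - ∑ i ∈ A n, e i) := by
          rw [hTz, hTz, smul_sub]; abel
        have hTn : d * 2 ^ k ≤ ‖T (z m) - T (z n)‖ := by
          rw [hTd, norm_smul, Real.norm_eq_abs, abs_of_pos hd]
          exact mul_le_mul_of_nonneg_left hS1 hd.le
        have hl := hlip (z m) (hz m) (z n) (hz n) (by nlinarith)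
        have hcle : c ≤ 2 ^ k := by
          rw [hc, mul_pow]
          have : q ^ k ≤ 1 := pow_le_one₀ hq0.le hq1.le
          nlinarith
        rw [← smul_sub, sub_sub_sub_cancel_right, norm_smul, Real.norm_eq_abs,
          abs_of_pos (inv_pos.2 hcpos), inv_mul_eq_div, div_le_div_iff₀ hLpos hcpos]
        nlinarith
      have hball : ∀ w : X, ‖x1 - w‖ ≤ c → c⁻¹ • (w - x1) ∈ closedBall (0 : X) 1 := by
        intro w hw
        rw [mem_closedBall_zero_iff, norm_smul, Real.norm_eq_abs,
          abs_of_pos (inv_pos.2 hcpos), inv_mul_eq_div, norm_sub_rev, div_le_one hcpos]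
        exact hw
      obtain ⟨m, hm⟩ := hβ1 (c⁻¹ • (x - x1)) (hball x (by rwa [norm_sub_rev]))
        (fun m => c⁻¹ • (z m - x1)) (fun m => hball _ (hnz m))
        (fun m n hmn => le_trans (min_le_left _ _) (hsep m n hmn))
      refine ⟨A1 ∪ A m, ?_, ?_, z m, hz m, ?_, ?_⟩
      · rw [Finset.card_union_of_disjoint (hdisj1 m), hA1, hAc, ← two_mul, ← pow_succ']
      · intro i hi
        rcases Finset.mem_union.1 hi with hi | hi
        · obtain ⟨u, hu⟩ := hA1r i hi
          exact ⟨_, hu⟩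
        · obtain ⟨u, hu⟩ := hAr m i hi
          exact ⟨_, hu⟩
      · rw [hTz, hT1, Finset.sum_union (hdisj1 m), smul_add, add_assoc]
      · rw [← smul_sub, sub_sub_sub_cancel_right, norm_smul, Real.norm_eq_abs,
          abs_of_pos (inv_pos.2 hcpos), inv_mul_eq_div, div_div,
          div_le_iff₀ (by positivity)] at hm
        rw [pow_succ, ← hc]
        nlinarith
  obtain ⟨x, hx⟩ := hS
  obtain ⟨A, hA, _, x', hx', hT, hn⟩ := key K le_rfl x hx id Function.injective_id
  have h := he2 A (fun _ => 1) (by simp)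
    (by rw [hA]; exact Nat.pow_le_pow_right (by norm_num) (by omega))
  simp only [one_smul] at h
  rw [hA] at h
  push_cast at h
  have hTn : d * (2 ^ K / 2) ≤ ‖T x' - T x‖ := by
    rw [hT, add_sub_cancel_left, norm_smul, Real.norm_eq_abs, abs_of_pos hd]
    exact mul_le_mul_of_nonneg_left h hd.le
  have hpow1 : (1 : ℝ) ≤ 2 ^ K := one_le_pow₀ (by norm_num)
  have hl := hlip x' hx' x hx (by nlinarith)
  rw [norm_sub_rev x' x] at hl
  rw [mul_pow] at hn
  rw [lt_div_iff₀ (by positivity)] at hK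
  have h1 : L * ‖x - x'‖ ≤ L * (2 ^ K * q ^ K) := mul_le_mul_of_nonneg_left hn hLpos.le
  have h2 : 2 ^ K * (q ^ K * (2 * L)) < 2 ^ K * d := mul_lt_mul_of_pos_left hK (by positivity)
  nlinarith

theorem aux_rpow (K c : ℕ) (p : ℝ) (hp : 1 < p) (hp2 : p ≤ 1 + 1 / ((K : ℝ) + 1))
    (hc : c ≤ 2 ^ (K + 1)) : (c : ℝ) / 2 ≤ (c : ℝ) ^ (1 / p) := by
  rcases Nat.eq_zero_or_pos c with h0 | h0
  · subst h0
    rw [Nat.cast_zero, zero_div]; positivity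
  have hc0 : (0 : ℝ) < c := by exact_mod_cast h0
  have hc1 : (1 : ℝ) ≤ c := by exact_mod_cast h0
  have hK : (0 : ℝ) < (K : ℝ) + 1 := by positivity
  have hexp : 1 - 1 / p ≤ 1 / ((K : ℝ) + 1) := by
    have : 1 - 1 / p ≤ p - 1 := by
      rw [← sub_nonneg]
      have : p - 1 - (1 - 1 / p) = (p - 1) ^ 2 / p := by field_simp
      rw [this]; positivity
    linarith
  have h1 : (c : ℝ) ^ (1 - 1 / p) ≤ 2 := by
    calc (c : ℝ) ^ (1 - 1 / p) ≤ (c : ℝ) ^ (1 / ((K : ℝ) + 1)) :=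
          Real.rpow_le_rpow_of_exponent_le hc1 hexp
      _ ≤ ((2 : ℝ) ^ (K + 1)) ^ (1 / ((K : ℝ) + 1)) :=
          Real.rpow_le_rpow hc0.le (by exact_mod_cast hc) (by positivity)
      _ = 2 := by
          rw [← Real.rpow_natCast, ← Real.rpow_mul (by norm_num)]
          push_cast
          rw [mul_one_div_cancel hK.ne', Real.rpow_one]
  have h2 : (c : ℝ) ^ (1 - 1 / p) * (c : ℝ) ^ (1 / p) = c := by
    rw [← Real.rpow_add hc0]; simp
  have h3 : (0 : ℝ) ≤ (c : ℝ) ^ (1 / p) := by positivity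
  nlinarith

open MeasureTheory in
theorem aux_Lp {α : Type*} [MeasurableSpace α] (μ : Measure α) (p : ℝ) (hp : 1 < p)
    [Fact (1 ≤ ENNReal.ofReal p)] (E : ℕ → Set α) (hE : ∀ i, MeasurableSet (E i))
    (hd : Pairwise (Function.onFun Disjoint E)) (h0 : ∀ i, μ (E i) ≠ 0) (h1 : ∀ i, μ (E i) ≠ ⊤) :
    ∃ e : ℕ → Lp ℝ (ENNReal.ofReal p) μ, ∀ (A : Finset ℕ) (σ : ℕ → ℝ), (∀ i, |σ i| = 1) →
      ‖∑ i ∈ A, σ i • e i‖ = (A.card : ℝ) ^ (1 / p) := by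
  have hp0 : 0 < p := by linarith
  have hpn : ENNReal.ofReal p ≠ 0 := by simpa using hp0
  have hpt : (ENNReal.ofReal p).toReal = p := ENNReal.toReal_ofReal hp0.le
  set b : ℕ → ℝ := fun i => (μ (E i)).toReal ^ (-(1 / p)) with hb
  have hbpos : ∀ i, 0 < b i := fun i =>
    Real.rpow_pos_of_pos (ENNReal.toReal_pos (h0 i) (h1 i)) _
  refine ⟨fun i => indicatorConstLp (ENNReal.ofReal p) (hE i) (h1 i) (b i), ?_⟩
  intro A σ hσ
  rw [Lp.norm_def]
  have hcoe : (⇑(∑ i ∈ A, σ i • indicatorConstLp (ENNReal.ofReal p) (hE i) (h1 i) (b i)) : α → ℝ)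
      =ᵐ[μ] fun x => ∑ i ∈ A, σ i * (E i).indicator (fun _ => b i) x := by
    classical
    induction A using Finset.induction_on with
    | empty =>
      simp only [Finset.sum_empty]
      exact Lp.coeFn_zero _ _ _
    | insert a s has ih =>
      rw [Finset.sum_insert has]
      filter_upwards [Lp.coeFn_add (σ a • indicatorConstLp (ENNReal.ofReal p) (hE a) (h1 a) (b a))
        (∑ i ∈ s, σ i • indicatorConstLp (ENNReal.ofReal p) (hE i) (h1 i) (b i)), ih,
        Lp.coeFn_smul (σ a) (indicatorConstLp (ENNReal.ofReal p) (hE a) (h1 a) (b a)),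
        indicatorConstLp_coeFn (p := ENNReal.ofReal p) (hs := hE a) (hμs := h1 a) (c := b a)]
        with x hx1 hx2 hx3 hx4
      rw [hx1, Pi.add_apply, hx2, hx3, Pi.smul_apply, hx4, Finset.sum_insert has, smul_eq_mul]
  rw [eLpNorm_congr_ae hcoe, eLpNorm_eq_lintegral_rpow_enorm_toReal hpn ENNReal.ofReal_ne_top, hpt]
  have hpt2 : ∀ x, ‖∑ i ∈ A, σ i * (E i).indicator (fun _ => b i) x‖ₑ ^ p
      = ∑ i ∈ A, (E i).indicator (fun _ => (μ (E i))⁻¹) x := by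
    intro x
    by_cases hx : ∃ i ∈ A, x ∈ E i
    · obtain ⟨i, hi, hxi⟩ := hx
      have hne : ∀ j, j ≠ i → x ∉ E j := fun j hj hxj =>
        Set.disjoint_left.1 (hd hj) hxj hxi
      rw [Finset.sum_eq_single i (fun j _ hj => by simp [hne j hj]) (fun h => absurd hi h),
        Finset.sum_eq_single i (fun j _ hj => by simp [hne j hj]) (fun h => absurd hi h)]
      simp only [Set.indicator_of_mem hxi]
      rw [← ofReal_norm, norm_mul, Real.norm_eq_abs, hσ, one_mul, Real.norm_eq_abs,
        abs_of_pos (hbpos i), ENNReal.ofReal_rpow_of_pos (hbpos i), hb]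
      simp only
      rw [← Real.rpow_mul ENNReal.toReal_nonneg]
      have : -(1 / p) * p = -1 := by field_simp
      rw [this, Real.rpow_neg_one,
        ENNReal.ofReal_inv_of_pos (ENNReal.toReal_pos (h0 i) (h1 i)), ENNReal.ofReal_toReal (h1 i)]
    · push Not at hx
      rw [Finset.sum_eq_zero (fun j hj => by simp [hx j hj]),
        Finset.sum_eq_zero (fun j hj => by simp [hx j hj])]
      simp [hp0]
  simp_rw [hpt2]
  rw [lintegral_finsetSum _ (fun i _ => measurable_const.indicator (hE i))]
  have : ∀ i ∈ A, ∫⁻ x, (E i).indicator (fun _ => (μ (E i))⁻¹) x ∂μ = 1 := by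
    intro i _
    rw [lintegral_indicator_const (hE i), ENNReal.inv_mul_cancel (h0 i) (h1 i)]
  rw [Finset.sum_congr rfl this]
  simp [← ENNReal.toReal_rpow]

/-- no uniform quotient map, Lipschitz for large distances, from a
subset of a space with property (β) onto `(∑ₙ L_{pₙ}[0,1])_{ℓ₂}` with `pₙ ↓ 1`. -/
theorem stmt6 {X : Type*} [NormedAddCommGroup X] [NormedSpace ℝ X] [CompleteSpace X]
    (p : ℕ → ℝ) (hp1 : ∀ n, 1 < p n) (hmono : Antitone p) (hlim : Tendsto p atTop (𝓝 1))
    [∀ n, Fact (1 ≤ ENNReal.ofReal (p n))]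
    (hX : PropertyBeta X) :
    ¬ ∃ (S : Set X) (T : X → lp (fun n => MeasureTheory.Lp ℝ (ENNReal.ofReal (p n))
          ((MeasureTheory.volume : MeasureTheory.Measure ℝ).restrict (Set.Icc 0 1))) 2),
        T '' S = Set.univ ∧ UniformQuotientOn T S ∧ LipschitzLargeDist T S := by
  rintro ⟨S, T, hT, hU, hL⟩
  have hS : S.Nonempty := by
    have : (0 : lp (fun n => MeasureTheory.Lp ℝ (ENNReal.ofReal (p n))
          ((MeasureTheory.volume : MeasureTheory.Measure ℝ).restrict (Set.Icc 0 1))) 2) ∈ T '' S := by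
      rw [hT]; trivial
    obtain ⟨x, hx, _⟩ := this
    exact ⟨x, hx⟩
  refine aux_core_s6 hX S T hS hU hL ?_
  intro N
  have hN : (1 : ℝ) < 1 + 1 / ((N : ℝ) + 1) := by
    have : (0 : ℝ) < 1 / ((N : ℝ) + 1) := by positivity
    linarith
  obtain ⟨n, hn⟩ := (hlim.eventually (gt_mem_nhds hN)).exists
  have hanti : Antitone (fun i : ℕ => (1 / ((i : ℝ) + 1))) := by
    intro i j hij
    have : (i : ℝ) ≤ j := by exact_mod_cast hij
    exact one_div_le_one_div_of_le (by positivity) (by linarith)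
  have hmeas : ∀ i : ℕ, ((MeasureTheory.volume : MeasureTheory.Measure ℝ).restrict (Set.Icc 0 1))
      (Set.Ioc (1 / (((i + 1 : ℕ) : ℝ) + 1)) (1 / ((i : ℝ) + 1))) ≠ 0 := by
    intro i
    have h1 : 1 / (((i + 1 : ℕ) : ℝ) + 1) < 1 / ((i : ℝ) + 1) := by
      push_cast
      exact one_div_lt_one_div_of_lt (by positivity) (by linarith)
    have h2 : 1 / ((i : ℝ) + 1) ≤ 1 := by
      rw [div_le_one (by positivity)]
      have : (0 : ℝ) ≤ i := by positivity
      linarith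
    have h3 : 0 ≤ 1 / (((i + 1 : ℕ) : ℝ) + 1) := by positivity
    rw [MeasureTheory.Measure.restrict_apply measurableSet_Ioc, Set.inter_eq_left.2
      (show Set.Ioc (1 / (((i + 1 : ℕ) : ℝ) + 1)) (1 / ((i : ℝ) + 1)) ⊆ Set.Icc 0 1 from
        fun x hx => ⟨h3.trans hx.1.le, hx.2.trans h2⟩), Real.volume_Ioc]
    simpa using h1
  obtain ⟨e, he⟩ := aux_Lp ((MeasureTheory.volume : MeasureTheory.Measure ℝ).restrict
    (Set.Icc 0 1)) (p n) (hp1 n)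
    (fun i : ℕ => Set.Ioc (1 / (((i + 1 : ℕ) : ℝ) + 1)) (1 / ((i : ℝ) + 1)))
    (fun i => measurableSet_Ioc) hanti.pairwise_disjoint_on_Ioc_succ
    hmeas (fun i => MeasureTheory.measure_ne_top _ _)
  refine ⟨fun i => lp.single 2 n (e i), ?_, ?_⟩
  · intro i
    rw [lp.norm_single (by norm_num)]
    have := he {i} (fun _ => 1) (by simp)
    simp only [Finset.sum_singleton, one_smul] at this
    rw [this]; simp
  · intro A σ hσ hA
    have : ∑ i ∈ A, σ i • lp.single (E := fun n => MeasureTheory.Lp ℝ (ENNReal.ofReal (p n))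
          ((MeasureTheory.volume : MeasureTheory.Measure ℝ).restrict (Set.Icc 0 1))) 2 n (e i)
        = lp.single 2 n (∑ i ∈ A, σ i • e i) := by
      simp only [← lp.single_smul]
      exact (map_sum (lp.singleAddMonoidHom
        (E := fun n => MeasureTheory.Lp ℝ (ENNReal.ofReal (p n))
          ((MeasureTheory.volume : MeasureTheory.Measure ℝ).restrict (Set.Icc 0 1))) 2 n) _ _).symm
    rw [this, lp.norm_single (by norm_num), he A σ hσ]
    exact aux_rpow N A.card (p n) (hp1 n) hn.le hA

end
end

section
/- Let 1 ≤ p < ∞ and let X = (∑_{k=1}^∞ E_k)_{ℓ_p}, where (E_k)_{k≥1} is a sequence of nonzero finite-dimensional normed spaces. Then for 0 ≤ t ≤ 2^{1/p}, the modulus of property (β) of X is β̄_X(t) = 1 − (1/2)·((1 + (1 − t^p/2)^{1/p})^p + t^p/2)^{1/p}. -/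
open Set Metric Filter Topology

noncomputable section

section Helpers

lemma aux_mono {p : ℝ} (hp : 1 ≤ p) {u v : ℝ} (hu : 0 ≤ u) (huv : u ≤ v) :
    v ^ p + (1 + u) ^ p ≤ u ^ p + (1 + v) ^ p := by
  obtain ⟨-, hc⟩ := convexOn_rpow hp
  have hd : 0 < 1 + (v - u) := by linarith
  have h1 := hc (x := u) (by simpa using hu) (y := 1 + v) (by simp; linarith)
    (a := 1 / (1 + (v - u))) (b := (v - u) / (1 + (v - u)))
    (by positivity) (div_nonneg (by linarith) hd.le) (by field_simp)
  have h2 := hc (x := u) (by simpa using hu) (y := 1 + v) (by simp; linarith)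
    (a := (v - u) / (1 + (v - u))) (b := 1 / (1 + (v - u)))
    (div_nonneg (by linarith) hd.le) (by positivity) (by field_simp; ring)
  simp only [smul_eq_mul] at h1 h2
  have e1 : 1 / (1 + (v - u)) * u + (v - u) / (1 + (v - u)) * (1 + v) = v := by
    field_simp; ring
  have e2 : (v - u) / (1 + (v - u)) * u + 1 / (1 + (v - u)) * (1 + v) = 1 + u := by
    field_simp; ring
  rw [e1] at h1
  rw [e2] at h2
  have e3 : 1 / (1 + (v - u)) + (v - u) / (1 + (v - u)) = 1 := by field_simp
  calc _ ≤ _ := add_le_add h1 h2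
    _ = (1 / (1 + (v - u)) + (v - u) / (1 + (v - u))) * (u ^ p + (1 + v) ^ p) := by ring
    _ = _ := by rw [e3, one_mul]

variable {p : ℝ} [Fact (1 ≤ ENNReal.ofReal p)]
    {E : ℕ → Type*} [∀ k, NormedAddCommGroup (E k)] [∀ k, NormedSpace ℝ (E k)]

lemma aux_hasSum (hp : 1 ≤ p) (f : lp E (ENNReal.ofReal p)) :
    HasSum (fun i => ‖f i‖ ^ p) (‖f‖ ^ p) := by
  have h : (ENNReal.ofReal p).toReal = p := ENNReal.toReal_ofReal (by linarith)
  have := lp.hasSum_norm (by rw [h]; linarith) f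
  rwa [h] at this

lemma aux_two (hp : 1 ≤ p) {i j : ℕ} (hij : i ≠ j) (a : E i) (b : E j) :
    ‖lp.single (ENNReal.ofReal p) i a + lp.single (ENNReal.ofReal p) j b‖ ^ p
      = ‖a‖ ^ p + ‖b‖ ^ p := by
  have hp0 : p ≠ 0 := by linarith
  refine (aux_hasSum hp _).unique ?_
  have := hasSum_sum_of_ne_finset_zero (s := {i, j}) (L := SummationFilter.unconditional ℕ)
    (f := fun k => ‖(lp.single (ENNReal.ofReal p) i a
      + lp.single (ENNReal.ofReal p) j b : lp E (ENNReal.ofReal p)) k‖ ^ p) (by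
      intro k hk
      simp only [Finset.mem_insert, Finset.mem_singleton, not_or] at hk
      simp [Pi.single_eq_of_ne hk.1, Pi.single_eq_of_ne hk.2, Real.zero_rpow hp0])
  rw [Finset.sum_pair hij] at this
  simpa [Pi.single_eq_of_ne hij, Pi.single_eq_of_ne hij.symm] using this

lemma aux_BL_fin (hp : 1 ≤ p) (w : lp E (ENNReal.ofReal p)) (s : Finset ℕ)
    (hw : ∀ k ∉ s, w k = 0)
    (z : ℕ → lp E (ENNReal.ofReal p)) (hz : ∀ k, Tendsto (fun n => z n k) atTop (𝓝 0))
    {a : ℝ} (ha : Tendsto (fun n => ‖z n‖) atTop (𝓝 a)) :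
    Tendsto (fun n => ‖w + z n‖) atTop (𝓝 ((‖w‖ ^ p + a ^ p) ^ (1 / p))) := by
  have hp0 : 0 < p := by linarith
  have key : ∀ n, ‖w + z n‖ = (‖z n‖ ^ p +
      ∑ k ∈ s, (‖w k + z n k‖ ^ p - ‖z n k‖ ^ p)) ^ (1 / p) := by
    intro n
    have h1 := (aux_hasSum hp (w + z n)).sub (aux_hasSum hp (z n))
    have h2 := hasSum_sum_of_ne_finset_zero (s := s) (L := SummationFilter.unconditional ℕ)
      (f := fun k => ‖(w + z n) k‖ ^ p - ‖z n k‖ ^ p) (by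
        intro k hk
        simp [hw k hk])
    have h3 := h1.unique h2
    simp only [lp.coeFn_add, Pi.add_apply] at h3
    rw [← h3, add_sub_cancel, one_div, Real.rpow_rpow_inv (norm_nonneg _) hp0.ne']
  have hwn : ‖w‖ ^ p = ∑ k ∈ s, ‖w k‖ ^ p := by
    refine (aux_hasSum hp w).unique (hasSum_sum_of_ne_finset_zero ?_)
    intro k hk
    simp [hw k hk, Real.zero_rpow hp0.ne']
  have cont : Continuous (fun x : ℝ => x ^ p) := Real.continuous_rpow_const hp0.le
  have cont' : Continuous (fun x : ℝ => x ^ (1 / p)) :=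
    Real.continuous_rpow_const (by positivity)
  simp_rw [key]
  refine (cont'.tendsto _).comp ?_
  rw [add_comm (‖w‖ ^ p)]
  refine ((cont.tendsto a).comp ha).add ?_
  rw [hwn]
  refine tendsto_finsetSum _ fun k _ => ?_
  have h1 : Tendsto (fun n => ‖w k + z n k‖) atTop (𝓝 ‖w k‖) := by
    simpa using ((tendsto_const_nhds (x := w k)).add (hz k)).norm
  have h2 : Tendsto (fun n => ‖z n k‖) atTop (𝓝 0) := by
    simpa using (hz k).norm
  have := ((cont.tendsto _).comp h1).sub ((cont.tendsto _).comp h2)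
  simpa [Real.zero_rpow hp0.ne', Function.comp_def] using this

lemma aux_BL (hp : 1 ≤ p) (w : lp E (ENNReal.ofReal p))
    (z : ℕ → lp E (ENNReal.ofReal p)) (hz : ∀ k, Tendsto (fun n => z n k) atTop (𝓝 0))
    {a : ℝ} (ha : Tendsto (fun n => ‖z n‖) atTop (𝓝 a)) :
    Tendsto (fun n => ‖w + z n‖) atTop (𝓝 ((‖w‖ ^ p + a ^ p) ^ (1 / p))) := by
  have hp0 : 0 < p := by linarith
  have cont : Continuous (fun x : ℝ => x ^ p) := Real.continuous_rpow_const hp0.le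
  have cont' : Continuous (fun x : ℝ => x ^ (1 / p)) :=
    Real.continuous_rpow_const (by positivity)
  have hs : Tendsto (fun s : Finset ℕ => ∑ i ∈ s, lp.single (ENNReal.ofReal p) i (w i))
    atTop (𝓝 w) := lp.hasSum_single ENNReal.ofReal_ne_top w
  refine TendstoUniformly.tendsto_of_eventually_tendsto (p := atTop (α := Finset ℕ))
    (F := fun s n => ‖(∑ i ∈ s, lp.single (ENNReal.ofReal p) i (w i)) + z n‖)
    (L := fun s => (‖∑ i ∈ s, lp.single (ENNReal.ofReal p) i (w i)‖ ^ p + a ^ p) ^ (1 / p))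
    ?_ ?_ ?_
  · rw [Metric.tendstoUniformly_iff]
    intro ε hε
    filter_upwards [Metric.tendsto_nhds.1 hs ε hε] with s hs n
    refine lt_of_le_of_lt ?_ hs
    rw [dist_comm, Real.dist_eq, dist_eq_norm]
    refine (abs_norm_sub_norm_le _ _).trans ?_
    rw [add_sub_add_right_eq_sub]
  · refine Eventually.of_forall fun s => ?_
    refine aux_BL_fin hp _ s ?_ z hz ha
    intro k hk
    rw [lp.coeFn_sum, Finset.sum_apply]
    refine Finset.sum_eq_zero fun i hi => ?_
    exact lp.single_apply_ne _ _ _ (by rintro rfl; exact hk hi)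
  · exact (cont'.tendsto _).comp (((cont.tendsto _).comp hs.norm).add tendsto_const_nhds)

lemma aux_lower [∀ k, FiniteDimensional ℝ (E k)] (hp : 1 ≤ p) {t : ℝ} (ht0 : 0 ≤ t)
    (x : lp E (ENNReal.ofReal p)) (hx : ‖x‖ ≤ 1)
    (xs : ℕ → lp E (ENNReal.ofReal p)) (hxs : ∀ n, ‖xs n‖ ≤ 1)
    (hsep : ∀ m n, m ≠ n → t ≤ ‖xs m - xs n‖) {C : ℝ}
    (hC : ((1 + (1 - t ^ p / 2) ^ (1 / p)) ^ p + t ^ p / 2) ^ (1 / p) < C) :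
    ∃ n, ‖x - xs n‖ ≤ C := by
  have hp0 : 0 < p := by linarith
  have hq0 : (ENNReal.ofReal p) ≠ 0 := (ENNReal.ofReal_pos.2 hp0).ne'
  have : ∀ k, ProperSpace (E k) := fun k => FiniteDimensional.proper_real (E k)
  obtain ⟨y₀, -, φ, hφ, hy₀⟩ := (isCompact_univ_pi
    (fun k => isCompact_closedBall (0 : E k) 1)).tendsto_subseq
    (x := fun n => (xs n : ∀ k, E k)) (fun n k _ => by
      simpa using (lp.norm_apply_le_norm hq0 (xs n) k).trans (hxs n))
  have hmem : Memℓp y₀ (ENNReal.ofReal p) := by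
    refine lp.memℓp_of_tendsto (F := fun n => xs (φ n)) (l := atTop) ?_ hy₀
    refine (Metric.isBounded_closedBall (x := (0 : lp E (ENNReal.ofReal p))) (r := 1)).subset ?_
    rintro _ ⟨n, rfl⟩
    simpa using hxs (φ n)
  obtain ⟨y, hy⟩ : ∃ y : lp E (ENNReal.ofReal p), (y : ∀ k, E k) = y₀ := ⟨⟨y₀, hmem⟩, rfl⟩
  subst hy
  obtain ⟨a, -, ψ, hψ, ha⟩ := tendsto_subseq_of_bounded
    (Metric.isBounded_closedBall (x := (0 : ℝ)) (r := 1 + ‖y‖))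
    (x := fun n => ‖xs (φ n) - y‖) (fun n => by
      simpa using (norm_sub_le _ _).trans (add_le_add (hxs (φ n)) le_rfl))
  set z : ℕ → lp E (ENNReal.ofReal p) := fun n => xs (φ (ψ n)) - y with hzdef
  have hz : ∀ k, Tendsto (fun n => z n k) atTop (𝓝 0) := by
    intro k
    have h1 := (tendsto_pi_nhds.1 hy₀ k).comp hψ.tendsto_atTop
    have h2 := h1.sub (tendsto_const_nhds (x := y k))
    simpa [z, Function.comp_def] using h2
  have ha : Tendsto (fun n => ‖z n‖) atTop (𝓝 a) := ha
  have ha0 : 0 ≤ a := ge_of_tendsto' ha fun n => norm_nonneg _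
  have hap : 0 ≤ a ^ p := Real.rpow_nonneg ha0 p
  have cont : Continuous (fun x : ℝ => x ^ p) := Real.continuous_rpow_const hp0.le
  have cont' : Continuous (fun x : ℝ => x ^ (1 / p)) :=
    Real.continuous_rpow_const (by positivity)
  -- first estimate
  have h1 : ‖y‖ ^ p + a ^ p ≤ 1 := by
    have := le_of_tendsto' (aux_BL hp y z hz ha) (b := 1) (fun n => by simpa [z] using hxs _)
    rw [one_div, Real.rpow_inv_le_iff_of_pos (by positivity) zero_le_one hp0] at this
    simpa using this
  -- second estimate
  have h2 : t ^ p ≤ 2 * a ^ p := by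
    have hm : ∀ m, t ≤ (‖z m‖ ^ p + a ^ p) ^ (1 / p) := by
      intro m
      have hB := aux_BL hp (- z m) z hz ha
      rw [norm_neg] at hB
      refine ge_of_tendsto hB ?_
      filter_upwards [eventually_gt_atTop m] with n hn
      have hne : φ (ψ n) ≠ φ (ψ m) := ((hφ.comp hψ) hn).ne'
      have := hsep _ _ hne
      have e : - z m + z n = xs (φ (ψ n)) - xs (φ (ψ m)) := by
        simp only [hzdef]; abel
      rwa [e]
    have := ge_of_tendsto' ((cont'.tendsto _).comp (((cont.tendsto _).comp ha).add
      (tendsto_const_nhds (x := a ^ p)))) hm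
    rw [one_div, Real.le_rpow_inv_iff_of_pos ht0 (by positivity) hp0] at this
    linarith
  -- third estimate
  have h3 := aux_BL hp (y - x) z hz ha
  have hyx : ‖y - x‖ ≤ 1 + ‖y‖ := by
    rw [norm_sub_rev]; exact (norm_sub_le _ _).trans (by linarith)
  have hv0 : 0 ≤ (1 - t ^ p / 2) := by
    have : 0 ≤ ‖y‖ ^ p := by positivity
    linarith
  have huv : ‖y‖ ≤ (1 - t ^ p / 2) ^ (1 / p) := by
    rw [one_div, Real.le_rpow_inv_iff_of_pos (norm_nonneg _) hv0 hp0]; linarith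
  have hvp : ((1 - t ^ p / 2) ^ (1 / p)) ^ p = 1 - t ^ p / 2 := by
    rw [one_div, Real.rpow_inv_rpow hv0 hp0.ne']
  have h4 : ‖y - x‖ ^ p + a ^ p ≤ (1 + (1 - t ^ p / 2) ^ (1 / p)) ^ p + t ^ p / 2 := by
    have e1 : ‖y - x‖ ^ p ≤ (1 + ‖y‖) ^ p := Real.rpow_le_rpow (norm_nonneg _) hyx hp0.le
    have e2 := aux_mono hp (norm_nonneg y) huv
    rw [hvp] at e2
    linarith
  have h5 : (‖y - x‖ ^ p + a ^ p) ^ (1 / p) < C :=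
    (Real.rpow_le_rpow (by positivity) h4 (by positivity)).trans_lt hC
  obtain ⟨n, hn⟩ := (h3.eventually_lt_const h5).exists
  refine ⟨φ (ψ n), ?_⟩
  rw [norm_sub_rev]
  have e : y - x + z n = xs (φ (ψ n)) - x := by
    simp only [hzdef]; abel
  rw [← e]
  exact hn.le

lemma aux_upper [∀ k, Nontrivial (E k)] (hp : 1 ≤ p) {t : ℝ} (ht0 : 0 ≤ t)
    (ht : t ≤ (2 : ℝ) ^ (1 / p)) :
    ∃ x : lp E (ENNReal.ofReal p), ∃ xs : ℕ → lp E (ENNReal.ofReal p), ‖x‖ ≤ 1 ∧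
      (∀ n, ‖xs n‖ ≤ 1) ∧ (∀ m n, m ≠ n → t ≤ ‖xs m - xs n‖) ∧
      ∀ n, ‖x - xs n‖ = ((1 + (1 - t ^ p / 2) ^ (1 / p)) ^ p + t ^ p / 2) ^ (1 / p) := by
  have hp0 : 0 < p := by linarith
  have hq0 : 0 < (ENNReal.ofReal p) := ENNReal.ofReal_pos.2 hp0
  have htp : 0 ≤ t ^ p := Real.rpow_nonneg ht0 p
  have hv0 : 0 ≤ (1 - t ^ p / 2) := by
    rw [one_div, Real.le_rpow_inv_iff_of_pos ht0 (by norm_num) hp0] at ht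
    linarith
  choose e he using fun k => exists_norm_eq (E k) zero_le_one
  set s := (1 - t ^ p / 2) ^ (1 / p) with hs
  set r := (t ^ p / 2) ^ (1 / p) with hr
  have hs0 : 0 ≤ s := Real.rpow_nonneg hv0 _
  have hr0 : 0 ≤ r := Real.rpow_nonneg (by linarith) _
  have hsp : s ^ p = 1 - t ^ p / 2 := by
    rw [hs, one_div, Real.rpow_inv_rpow hv0 hp0.ne']
  have hrp : r ^ p = t ^ p / 2 := by
    rw [hr, one_div, Real.rpow_inv_rpow (by linarith) hp0.ne']
  refine ⟨lp.single _ 0 (e 0), fun n => lp.single _ 0 (-(s • e 0)) +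
    lp.single _ (n + 1) (r • e (n + 1)), ?_, ?_, ?_, ?_⟩
  · rw [lp.norm_single hq0, he]
  · intro n
    rw [← Real.rpow_le_rpow_iff (norm_nonneg _) zero_le_one hp0, aux_two hp (by omega)]
    simp only [norm_neg, norm_smul, he, mul_one, Real.norm_eq_abs, abs_of_nonneg hs0,
      abs_of_nonneg hr0, hsp, hrp, Real.one_rpow]
    linarith
  · intro m n hmn
    rw [add_sub_add_left_eq_sub, sub_eq_add_neg, ← lp.single_neg,
      ← Real.rpow_le_rpow_iff ht0 (norm_nonneg _) hp0, aux_two hp (by omega)]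
    simp only [norm_neg, norm_smul, he, mul_one, Real.norm_eq_abs,
      abs_of_nonneg hr0, hrp]
    linarith
  · intro n
    have e1 : (lp.single (ENNReal.ofReal p) 0 (e 0) - (lp.single _ 0 (-(s • e 0)) +
        lp.single _ (n + 1) (r • e (n + 1))) : lp E (ENNReal.ofReal p)) =
        lp.single _ 0 ((1 + s) • e 0) + lp.single _ (n + 1) (-(r • e (n + 1))) := by
      rw [add_smul, one_smul, lp.single_add, lp.single_neg, lp.single_neg]; abel
    rw [e1, ← Real.rpow_left_inj (norm_nonneg _) (by positivity) hp0.ne', aux_two hp (by omega),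
      one_div, Real.rpow_inv_rpow (by positivity) hp0.ne']
    simp only [norm_neg, norm_smul, he, mul_one, Real.norm_eq_abs,
      abs_of_nonneg hr0, hrp, abs_of_nonneg (add_nonneg zero_le_one hs0)]

end Helpers

/-- Proposition `prop1`: the modulus of property (β) of an
`ℓ_p`-sum of finite-dimensional spaces. -/
theorem stmt8 (p : ℝ) (hp : 1 ≤ p) [Fact (1 ≤ ENNReal.ofReal p)]
    (E : ℕ → Type*) [∀ k, NormedAddCommGroup (E k)] [∀ k, NormedSpace ℝ (E k)]
    [∀ k, FiniteDimensional ℝ (E k)] [∀ k, Nontrivial (E k)]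
    (t : ℝ) (ht0 : 0 ≤ t) (ht : t ≤ (2 : ℝ) ^ (1 / p)) :
    betaMod (lp E (ENNReal.ofReal p)) t =
      1 - (1 / 2) * (((1 + (1 - t ^ p / 2) ^ (1 / p)) ^ p + t ^ p / 2) ^ (1 / p)) := by
  set F := ((1 + (1 - t ^ p / 2) ^ (1 / p)) ^ p + t ^ p / 2) ^ (1 / p) with hF
  obtain ⟨x, xs, hx, hxs, hsep, hd⟩ := aux_upper (E := E) hp ht0 ht
  have hub : ∀ δ ∈ betaModSet (lp E (ENNReal.ofReal p)) t, δ ≤ 1 - (1 / 2) * F := by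
    rintro δ ⟨-, h⟩
    obtain ⟨n, hn⟩ := h x (by simpa using hx) xs (fun n => by simpa using hxs n) hsep
    rw [hd n, ← hF] at hn
    linarith
  have h0 : (0 : ℝ) ∈ betaModSet (lp E (ENNReal.ofReal p)) t := by
    refine ⟨le_rfl, fun x hx xs hxs _ => ⟨0, ?_⟩⟩
    have h1 : ‖x‖ ≤ 1 := by simpa using hx
    have h2 : ‖xs 0‖ ≤ 1 := by simpa using hxs 0
    have := norm_sub_le x (xs 0)
    linarith
  unfold betaMod
  refine csSup_eq_of_forall_le_of_forall_lt_exists_gt ⟨0, h0⟩ hub ?_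
  intro w hw
  rcases lt_or_ge w 0 with hw0 | hw0
  · exact ⟨0, h0, hw0⟩
  obtain ⟨δ, hδ1, hδ2⟩ := exists_between hw
  refine ⟨δ, ⟨by linarith, ?_⟩, hδ1⟩
  intro x hx xs hxs hsep
  obtain ⟨n, hn⟩ := aux_lower hp ht0 x (by simpa using hx) xs (fun n => by simpa using hxs n)
    hsep (C := 2 * (1 - δ)) (by rw [← hF]; linarith)
  exact ⟨n, by linarith⟩

end
end

section
/- Let 1 < p < ∞, let W be a closed linear subspace of an ℓ_p-sum of nonzero finite-dimensional normed spaces, and let X be a Banach space for which there is a surjective bounded linear map Q : W → X. Assume a Banach space Y is the image of a uniform quotient map from a subset of X which is Lipschitz for large distances. Then Y contains no closed linear subspace isomorphic to ℓ_q for any q > p. -/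
open Set Metric Filter Topology

noncomputable section

lemma beta_scalar (p : ℝ) (hp : 1 < p) : ∃ c > 0, ∀ a A B ρ N : ℝ, 0 < a → 0 ≤ A → 0 ≤ B → 0 ≤ ρ →
    0 ≤ N → A ≤ a → B ^ p + ρ ^ p ≤ a ^ p → N ^ p ≤ (A + B) ^ p + ρ ^ p →
    N ≤ 2 * a - a * c * (ρ / a) ^ p := by
  have hp0 : 0 < p := by linarith
  have hip : p⁻¹ < 1 := inv_lt_one_of_one_lt₀ hp
  have hip0 : 0 < p⁻¹ := inv_pos.2 hp0
  set c0 : ℝ := (2 - p⁻¹) ^ (p - 1) - 1 with hc0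
  have hc0pos : 0 < c0 := by
    have := Real.one_lt_rpow (x := 2 - p⁻¹) (z := p - 1) (by linarith) (by linarith)
    linarith
  have h2p : (0:ℝ) < 2 ^ p := by positivity
  refine ⟨2 * c0 / (p * 2 ^ p), by positivity, ?_⟩
  intro a A B ρ N ha hA hB hρ hN hAa hBρ hNp
  set σ := (ρ / a) ^ p with hσ
  have hσ0 : 0 ≤ σ := by positivity
  have hbσ : (B / a) ^ p + σ ≤ 1 := by
    rw [hσ, Real.div_rpow hB ha.le, Real.div_rpow hρ ha.le, ← add_div]
    exact (div_le_one (by positivity)).2 hBρ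
  have hσ1 : σ ≤ 1 := by
    have : 0 ≤ (B / a) ^ p := by positivity
    linarith
  set h := σ * p⁻¹ with hh
  have hh0 : 0 ≤ h := by positivity
  have hh1 : h ≤ p⁻¹ := by
    rw [hh]; nlinarith
  have hph : p * h = σ := by rw [hh]; field_simp
  have hb : B / a ≤ 1 - h := by
    have h1 := one_add_mul_self_le_rpow_one_add (s := -h) (by linarith) hp.le
    have h2 : (B / a) ^ p ≤ (1 - h) ^ p := by
      have : (1 + -h) = 1 - h := by ring
      rw [this] at h1
      linarith
    exact (Real.rpow_le_rpow_iff (by positivity) (by linarith) hp0).1 h2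
  have hν : (N / a) ^ p ≤ (2 - h) ^ p + σ := by
    have h1 : (N / a) ^ p ≤ ((A + B) / a) ^ p + σ := by
      rw [hσ, Real.div_rpow hN ha.le, Real.div_rpow hρ ha.le, Real.div_rpow (by positivity) ha.le,
        ← add_div]
      gcongr
    have h2 : (A + B) / a ≤ 2 - h := by
      rw [add_div]
      have : A / a ≤ 1 := (div_le_one ha).2 hAa
      linarith
    have h3 : ((A + B) / a) ^ p ≤ (2 - h) ^ p := Real.rpow_le_rpow (by positivity) h2 hp0.le
    linarith
  have h2h : 0 < 2 - h := by linarith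
  have htan : (2 - h) ^ p + σ * (2 - h) ^ (p - 1) ≤ 2 ^ p := by
    have h1 := one_add_mul_self_le_rpow_one_add (s := h / (2 - h))
      (by have : 0 ≤ h / (2 - h) := by positivity
          linarith) hp.le
    have h2 : (2:ℝ) = (2 - h) * (1 + h / (2 - h)) := by field_simp; ring
    have h3 : (2:ℝ) ^ p = (2 - h) ^ p * (1 + h / (2 - h)) ^ p := by
      conv_lhs => rw [h2]
      rw [Real.mul_rpow h2h.le (by positivity)]
    have h4 : (2 - h) ^ (p - 1) = (2 - h) ^ p / (2 - h) := by
      rw [Real.rpow_sub h2h, Real.rpow_one]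
    rw [h3, h4, ← hph]
    have h5 : 0 < (2 - h) ^ p := by positivity
    calc (2 - h) ^ p + p * h * ((2 - h) ^ p / (2 - h))
        = (2 - h) ^ p * (1 + p * (h / (2 - h))) := by field_simp
      _ ≤ _ := by gcongr
  have hc0le : c0 + 1 ≤ (2 - h) ^ (p - 1) := by
    have : (2 - p⁻¹) ^ (p - 1) ≤ (2 - h) ^ (p - 1) :=
      Real.rpow_le_rpow (by linarith) (by linarith) (by linarith)
    linarith
  have hν2 : (N / a) ^ p ≤ 2 ^ p - c0 * σ := by nlinarith
  have hc2 : c0 ≤ 2 ^ p := by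
    have : (2 - p⁻¹) ^ (p - 1) ≤ 2 ^ p :=
      (Real.rpow_le_rpow (by linarith) (by linarith) (by linarith)).trans
        (Real.rpow_le_rpow_of_exponent_le (by norm_num) (by linarith : p - 1 ≤ p))
    linarith
  set k := c0 * σ / (p * 2 ^ p) with hk
  have hk1 : k ≤ 1 := by
    rw [hk, div_le_one (by positivity)]
    nlinarith [mul_le_mul hc2 hσ1 hσ0 h2p.le]
  have hν3 : N / a ≤ 2 * (1 - k) := by
    have h1 := one_add_mul_self_le_rpow_one_add (s := -k) (by linarith) hp.le
    have e1 : (1 + -k) = 1 - k := by ring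
    rw [e1] at h1
    refine (Real.rpow_le_rpow_iff (by positivity) (by linarith) hp0).1 (hν2.trans ?_)
    rw [Real.mul_rpow (by norm_num) (by linarith)]
    calc 2 ^ p - c0 * σ = 2 ^ p * (1 + p * -k) := by rw [hk]; field_simp; ring
      _ ≤ _ := by gcongr
  rw [div_le_iff₀ ha] at hν3
  refine hν3.trans (le_of_eq ?_)
  rw [hk]; field_simp

/-- existence of good finite rank projections -/
def HasProj (V : Type*) [NormedAddCommGroup V] [NormedSpace ℝ V] (p : ℝ) : Prop :=
  ∀ (x : V) (η : ℝ), 0 < η → ∃ P : V →ₗ[ℝ] V, (∀ f, ‖f‖ ^ p = ‖P f‖ ^ p + ‖f - P f‖ ^ p) ∧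
    (∀ f, P (P f) = P f) ∧ ‖x - P x‖ < η ∧
    ∀ (w : ℕ → V) (M : ℝ), (∀ n, ‖w n‖ ≤ M) → ∀ ε > 0, ∃ m n, m ≠ n ∧ ‖P (w m) - P (w n)‖ < ε

/-- power type beta -/
def BetaPow (V : Type*) [NormedAddCommGroup V] (p : ℝ) : Prop :=
  ∃ c > 0, ∀ a s : ℝ, 0 < a → 0 < s → ∀ (x : V) (w : ℕ → V), ‖x‖ ≤ a → (∀ n, ‖w n‖ ≤ a) →
    (∀ m n, m ≠ n → s ≤ ‖w m - w n‖) → ∃ n, ‖x - w n‖ ≤ 2 * a - a * c * (s / a) ^ p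

lemma betaPow_of_hasProj {V : Type*} [NormedAddCommGroup V] [NormedSpace ℝ V] (p : ℝ) (hp : 1 < p)
    (h : HasProj V p) : BetaPow V p := by
  have hp0 : 0 < p := by linarith
  obtain ⟨c, hc, hcs⟩ := beta_scalar p hp
  refine ⟨c / (2 * 4 ^ p), by positivity, ?_⟩
  intro a s ha hs x w hx hw hsep
  set η := a * (c / (2 * 4 ^ p)) * (s / a) ^ p with hη
  have hηpos : 0 < η := by positivity
  obtain ⟨P, hP1, hP2, hP3, hP4⟩ := h x η hηpos
  obtain ⟨m, n, hmn, hlt⟩ := hP4 w a hw (s / 2) (by positivity)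
  have key : ∃ k, s / 4 ≤ ‖w k - P (w k)‖ := by
    by_contra! hcon
    have h1 := hcon m
    have h2 := hcon n
    have h3 := hsep m n hmn
    have h4 : w m - w n = (w m - P (w m)) - (w n - P (w n)) + (P (w m) - P (w n)) := by abel
    have h5 : ‖w m - w n‖ ≤ ‖w m - P (w m)‖ + ‖w n - P (w n)‖ + ‖P (w m) - P (w n)‖ := by
      rw [h4]
      exact (norm_add_le _ _).trans (by gcongr; exact norm_sub_le _ _)
    linarith
  obtain ⟨k, hk⟩ := key
  refine ⟨k, ?_⟩
  have hPx : ‖P x‖ ≤ a := by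
    refine le_trans ?_ hx
    refine (Real.rpow_le_rpow_iff (norm_nonneg _) (norm_nonneg _) hp0).1 ?_
    have : 0 ≤ ‖x - P x‖ ^ p := by positivity
    linarith [hP1 x]
  have hN := hcs a ‖P x‖ ‖P (w k)‖ ‖w k - P (w k)‖ ‖P x - w k‖ ha (norm_nonneg _) (norm_nonneg _)
    (norm_nonneg _) (norm_nonneg _) hPx
    (by rw [← hP1]; exact Real.rpow_le_rpow (norm_nonneg _) (hw k) hp0.le)
    (by
      rw [hP1 (P x - w k), map_sub, hP2]
      have e : P x - w k - (P x - P (w k)) = -(w k - P (w k)) := by abel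
      rw [e, norm_neg]
      gcongr
      exact norm_sub_le _ _)
  have h6 : (s / 4 / a) ^ p ≤ (‖w k - P (w k)‖ / a) ^ p := by gcongr
  have h7 : a * c * (s / 4 / a) ^ p = 2 * η := by
    have : s / 4 / a = (s / a) / 4 := by ring
    rw [this, Real.div_rpow (by positivity) (by norm_num), hη]
    field_simp
  have h8 : a * c * (s / 4 / a) ^ p ≤ a * c * (‖w k - P (w k)‖ / a) ^ p := by gcongr
  have h9 : ‖x - w k‖ ≤ ‖x - P x‖ + ‖P x - w k‖ := by
    have : x - w k = (x - P x) + (P x - w k) := by abel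
    rw [this]; exact norm_add_le _ _
  linarith

lemma hasProj_lp (p : ℝ) (hp : 1 < p) [Fact (1 ≤ ENNReal.ofReal p)]
    (E : ℕ → Type*) [∀ k, NormedAddCommGroup (E k)] [∀ k, NormedSpace ℝ (E k)]
    [∀ k, FiniteDimensional ℝ (E k)] : HasProj (lp E (ENNReal.ofReal p)) p := by
  have hp0 : 0 < p := by linarith
  have htr : (ENNReal.ofReal p).toReal = p := ENNReal.toReal_ofReal hp0.le
  have htr0 : 0 < (ENNReal.ofReal p).toReal := by rw [htr]; exact hp0
  have hne : ENNReal.ofReal p ≠ 0 := by simpa using hp0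
  intro x η hη
  have hs := lp.hasSum_single (E := E) ENNReal.ofReal_ne_top x
  rw [HasSum, Metric.tendsto_nhds] at hs
  obtain ⟨F, hF⟩ := (hs η hη).exists
  let P : lp E (ENNReal.ofReal p) →ₗ[ℝ] lp E (ENNReal.ofReal p) :=
    { toFun := fun f => ∑ i ∈ F, lp.single _ i (f i)
      map_add' := by
        intro f g
        simp [lp.single_add, Finset.sum_add_distrib]
      map_smul' := by
        intro r f
        simp only [lp.coeFn_smul, Pi.smul_apply, RingHom.id_apply, Finset.smul_sum]
        exact Finset.sum_congr rfl fun i _ => lp.single_smul _ _ _ _ }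
  have hPdef : ∀ f, P f = ∑ i ∈ F, lp.single _ i (f i) := fun f => rfl
  refine ⟨P, ?_, ?_, ?_, ?_⟩
  · intro f
    have h1 := lp.norm_compl_sum_single htr0 f F
    have h2 := lp.norm_sum_single htr0 (fun i => f i) F
    rw [htr] at h1 h2
    rw [hPdef, h1, h2]; ring
  · intro f
    rw [hPdef, hPdef]
    refine Finset.sum_congr rfl fun i hi => ?_
    congr 1
    simp only [lp.coeFn_sum, lp.coeFn_single, Finset.sum_apply, Finset.sum_pi_single, if_pos hi]
  · rw [← dist_eq_norm, dist_comm]; exact hF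
  · intro w M hM ε hε
    let G : (∀ i : F, E i) → lp E (ENNReal.ofReal p) :=
      fun v => ∑ i : F, lp.single _ (i : ℕ) (v i)
    have hG : Continuous G := by
      refine continuous_finset_sum _ fun i _ => ?_
      exact (lp.isometry_single (E := E) (p := ENNReal.ofReal p) (i : ℕ)).continuous.comp
        (continuous_apply i)
    have hGP : ∀ f : lp E (ENNReal.ofReal p), G (fun i => f i) = P f := by
      intro f
      rw [hPdef]
      exact Finset.sum_coe_sort F (fun i => lp.single (ENNReal.ofReal p) i (f i))
    haveI : ∀ i : F, ProperSpace (E i) := fun i => FiniteDimensional.proper ℝ (E i)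
    have hb : ∀ n, (fun i : F => w n i) ∈ closedBall (0 : ∀ i : F, E i) M := by
      intro n
      rw [mem_closedBall_zero_iff]
      refine (pi_norm_le_iff_of_nonneg ((norm_nonneg _).trans (hM 0))).2 fun i => ?_
      exact (lp.norm_apply_le_norm hne (w n) i).trans (hM n)
    obtain ⟨v, -, φ, hφ, hlim⟩ := tendsto_subseq_of_bounded isBounded_closedBall hb
    have hlim2 : Tendsto (fun n => P (w (φ n))) atTop (𝓝 (G v)) := by
      have := (hG.tendsto v).comp hlim
      refine this.congr fun n => ?_
      exact hGP (w (φ n))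
    obtain ⟨N, hN⟩ := Metric.cauchySeq_iff.1 hlim2.cauchySeq ε hε
    refine ⟨φ N, φ (N+1), (hφ (Nat.lt_succ_self N)).ne, ?_⟩
    rw [← dist_eq_norm]
    exact hN N le_rfl (N+1) (Nat.le_succ N)

/-- target side property -/
def SmoothSeq (F : Type*) [NormedAddCommGroup F] (q : ℝ) : Prop :=
  ∀ (u : F) (τ : ℝ), u ≠ 0 → 0 < τ → ∃ e : ℕ → F, (∀ m n, m ≠ n → τ ≤ ‖e m - e n‖) ∧
    ∀ n, ‖u + e n‖ ≤ ‖u‖ * (1 + (2 * τ / ‖u‖) ^ q) ∧ ‖u - e n‖ ≤ ‖u‖ * (1 + (2 * τ / ‖u‖) ^ q)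

lemma smoothSeq_lp (q : ℝ) (hq : 1 < q) [Fact (1 ≤ ENNReal.ofReal q)] :
    SmoothSeq (lp (fun _ : ℕ => ℝ) (ENNReal.ofReal q)) q := by
  have hp0 : 0 < q := by linarith
  have htr : (ENNReal.ofReal q).toReal = q := ENNReal.toReal_ofReal hp0.le
  have htr0 : 0 < (ENNReal.ofReal q).toReal := by rw [htr]; exact hp0
  have hne : ENNReal.ofReal q ≠ 0 := by simpa using hp0
  intro u τ hu hτ
  have hu0 : 0 < ‖u‖ := norm_pos_iff.2 hu
  have hsum := (lp.memℓp u).summable htr0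
  rw [htr] at hsum
  have hev : ∀ᶠ n in atTop, ‖u n‖ ^ q < τ ^ q :=
    (tendsto_order.1 hsum.tendsto_atTop_zero).2 _ (by positivity)
  obtain ⟨N, hN⟩ := eventually_atTop.1 hev
  have hN' : ∀ n, N ≤ n → ‖u n‖ ≤ τ := fun n hn =>
    ((Real.rpow_lt_rpow_iff (norm_nonneg _) hτ.le hp0).1 (hN n hn)).le
  have gen : ∀ n, N ≤ n → ∀ r : ℝ, |r| = τ →
      ‖u + lp.single (ENNReal.ofReal q) n r‖ ≤ ‖u‖ * (1 + (2 * τ / ‖u‖) ^ q) := by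
    intro n hn r hr
    have h1 := lp.norm_compl_sum_single htr0 (u + lp.single (ENNReal.ofReal q) n r) {n}
    have h2 := lp.norm_compl_sum_single htr0 u {n}
    rw [htr] at h1 h2
    simp only [Finset.sum_singleton, lp.coeFn_add, Pi.add_apply, lp.single_apply_self,
      lp.single_add] at h1 h2
    rw [add_sub_add_right_eq_sub] at h1
    have h3 : ‖u n + r‖ ^ q ≤ (2 * τ) ^ q := by
      refine Real.rpow_le_rpow (norm_nonneg _) ?_ hp0.le
      refine (norm_add_le _ _).trans ?_
      have := hN' n hn
      rw [Real.norm_eq_abs r, hr]; linarith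
    have h4 : 0 ≤ ‖u n‖ ^ q := by positivity
    have h5 : ‖u + lp.single (ENNReal.ofReal q) n r‖ ^ q ≤ ‖u‖ ^ q + (2 * τ) ^ q := by linarith
    have hx : 0 ≤ (2 * τ / ‖u‖) ^ q := by positivity
    refine (Real.rpow_le_rpow_iff (norm_nonneg _) (by positivity) hp0).1 (h5.trans ?_)
    rw [Real.mul_rpow hu0.le (by positivity)]
    have h6 := Real.rpow_le_rpow_of_exponent_le
      (by linarith : 1 ≤ 1 + (2 * τ / ‖u‖) ^ q) hq.le
    rw [Real.rpow_one] at h6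
    calc ‖u‖ ^ q + (2 * τ) ^ q = ‖u‖ ^ q * (1 + (2 * τ / ‖u‖) ^ q) := by
          rw [Real.div_rpow (by positivity) hu0.le]; field_simp
      _ ≤ _ := by gcongr
  refine ⟨fun n => lp.single (ENNReal.ofReal q) (N + n) τ, ?_, ?_⟩
  · intro m n hmn
    have h1 := lp.norm_apply_le_norm hne
      (lp.single (E := fun _ : ℕ => ℝ) (ENNReal.ofReal q) (N + m) τ
        - lp.single (ENNReal.ofReal q) (N + n) τ) (N + m)
    rw [lp.coeFn_sub, Pi.sub_apply, lp.single_apply_self, lp.single_apply_ne _ _ _ (by omega),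
      sub_zero, Real.norm_eq_abs, abs_of_pos hτ] at h1
    exact h1
  · intro n
    refine ⟨gen _ (by omega) τ (abs_of_pos hτ), ?_⟩
    have := gen (N + n) (by omega) (-τ) (by rw [abs_neg, abs_of_pos hτ])
    rwa [lp.single_neg, ← sub_eq_add_neg] at this

lemma exists_small (p q c g : ℝ) (hpq : p < q) (hp : 0 < p) (hc : 0 < c) (hg : 0 < g) :
    ∃ t > 0, t ≤ 1 / 6 ∧ (6 * t) ^ q ≤ c * (t * g) ^ p := by
  have hlim : Tendsto (fun t : ℝ => t ^ (q - p)) (𝓝[>] 0) (𝓝 0) := by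
    have h := (Real.continuousAt_rpow_const 0 (q - p) (Or.inr (by linarith))).tendsto
    rw [Real.zero_rpow (by linarith)] at h
    exact h.mono_left nhdsWithin_le_nhds
  have h1 := (tendsto_order.1 hlim).2 (c * g ^ p / 6 ^ q) (by positivity)
  have h2 : ∀ᶠ t : ℝ in 𝓝[>] 0, t ∈ Ioo (0:ℝ) (1/6) := Ioo_mem_nhdsGT (by norm_num)
  obtain ⟨t, ht1, ht2, ht3⟩ := (h1.and h2).exists
  refine ⟨t, ht2, ht3.le, ?_⟩
  rw [Real.mul_rpow (by norm_num) ht2.le, Real.mul_rpow ht2.le hg.le]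
  have e : t ^ q = t ^ (q - p) * t ^ p := by
    rw [← Real.rpow_add ht2]; congr 1; ring
  rw [e]
  have : 0 < t ^ p := by positivity
  rw [lt_div_iff₀ (by positivity)] at ht1
  nlinarith

lemma core {V F : Type*} [NormedAddCommGroup V] [NormedAddCommGroup F] [NormedSpace ℝ F]
    [Nontrivial F] (p q : ℝ) (hp : 1 < p) (hpq : p < q) (hβ : BetaPow V p) (hF : SmoothSeq F q)
    (R : V → F → Prop) (hne : ∃ w y, R w y) (L D₁ K₀ D₀ : ℝ) (hL : 0 < L)
    (h1 : ∀ w y w' y', R w y → R w' y' → ‖y - y'‖ ≤ L * ‖w - w'‖ + D₁)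
    (h2 : ∀ w y, R w y → ∀ y', ∃ w', R w' y' ∧ ‖w - w'‖ ≤ K₀ * ‖y - y'‖ + D₀) : False := by
  have hp0 : 0 < p := by linarith
  let G : ℝ → Prop := fun K => ∃ D, 0 ≤ D ∧
    ∀ w y, R w y → ∀ y', ∃ w', R w' y' ∧ ‖w - w'‖ ≤ K * ‖y - y'‖ + D
  have hG0 : G K₀ := by
    refine ⟨max D₀ 0, le_max_right _ _, fun w y hwy y' => ?_⟩
    obtain ⟨w', hw', hle⟩ := h2 w y hwy y'
    exact ⟨w', hw', hle.trans (by gcongr; exact le_max_left _ _)⟩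
  have hlow : ∀ K, G K → 1 / L ≤ K := by
    rintro K ⟨D, hD, hK⟩
    by_contra! hlt
    obtain ⟨w, y, hwy⟩ := hne
    have hLK : 0 < 1 - L * K := by
      rw [lt_div_iff₀ hL] at hlt; linarith
    obtain ⟨z, hz⟩ := NormedSpace.exists_lt_norm ℝ F ((L * D + D₁) / (1 - L * K))
    obtain ⟨w', hw', hle⟩ := hK w y hwy (y - z)
    have h3 := h1 w y w' (y - z) hwy hw'
    rw [sub_sub_cancel] at h3 hle
    rw [div_lt_iff₀ hLK] at hz
    nlinarith
  obtain ⟨c, hc, hβ⟩ := hβ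
  have hK₀ : 0 < K₀ := lt_of_lt_of_le (by positivity) (hlow _ hG0)
  obtain ⟨t, ht, ht6, hts⟩ := exists_small p q (c / 6) (1 / (2 * L * K₀)) hpq hp0 (by positivity)
    (by positivity)
  set θ := c / 6 * (t * (1 / (2 * L * K₀))) ^ p with hθ
  have hθ0 : 0 < θ := by positivity
  have himp : ∀ K, K ≤ K₀ → G K → G ((1 - θ) * K) := by
    rintro K hKK₀ hGK
    have hKlow := hlow K hGK
    have hK : 0 < K := lt_of_lt_of_le (by positivity) hKlow
    obtain ⟨D, hD, hlift⟩ := hGK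
    set A₀ := max (max (3 * D / K) (2 * D₁ / t)) 1 with hA₀
    have hA₀1 : 1 ≤ A₀ := le_max_right _ _
    refine ⟨3 * D + θ * K * A₀, by positivity, ?_⟩
    intro w y hwy y'
    set A := ‖y - y'‖ with hA
    rcases le_or_gt A A₀ with hAA | hAA
    · obtain ⟨w', hw', hle⟩ := hlift w y hwy y'
      refine ⟨w', hw', hle.trans ?_⟩
      have : θ * K * A ≤ θ * K * A₀ := by gcongr
      rw [← hA]
      linarith
    have hA0 : 0 < A := by linarith
    have hA1 : 3 * D ≤ K * A := by
      have : 3 * D / K ≤ A := ((le_max_left _ _).trans (le_max_left _ _)).trans hAA.le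
      rw [div_le_iff₀ hK] at this
      linarith
    have hA2 : 2 * D₁ ≤ t * A := by
      have : 2 * D₁ / t ≤ A := ((le_max_right _ _).trans (le_max_left _ _)).trans hAA.le
      rw [div_le_iff₀ ht] at this
      linarith
    set u : F := (3⁻¹ : ℝ) • (y' - y) with hu
    have hnu : ‖u‖ = A / 3 := by
      rw [hu, norm_smul, norm_sub_rev, ← hA]; norm_num; ring
    have hy' : y' = y + u + u + u := by
      have : u + u + u = y' - y := by
        rw [hu, ← add_smul, ← add_smul]; norm_num
      rw [add_assoc, add_assoc, ← add_assoc u, this]; abel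
    have hu0 : u ≠ 0 := by
      rw [← norm_pos_iff, hnu]; positivity
    obtain ⟨e, hesep, he⟩ := hF u (t * A) hu0 (by positivity)
    have hr : 2 * (t * A) / ‖u‖ = 6 * t := by rw [hnu]; field_simp; ring
    rw [hr, hnu] at he
    set ξ := (6 * t) ^ q with hξ
    have hξ0 : 0 ≤ ξ := by positivity
    have hξ1 : ξ ≤ 1 := Real.rpow_le_one (by positivity) (by linarith) (by linarith)
    set a := K * (A / 3 * (1 + ξ)) + D with ha
    have hKA : 0 < K * A := by positivity
    have ha_low : K * A / 3 ≤ a := by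
      have : 0 ≤ K * A * ξ := by positivity
      rw [ha]; linarith
    have ha0 : 0 < a := by linarith
    have ha_up : a ≤ K₀ * A := by
      have e1 : K * A * ξ ≤ K * A := by nlinarith
      have : K * A ≤ K₀ * A := by gcongr
      rw [ha]; linarith
    -- lifts
    obtain ⟨z, hz, hzle⟩ := hlift w y hwy (y + u)
    have hzle' : ‖w - z‖ ≤ a := by
      have e1 : y - (y + u) = -u := by abel
      rw [e1, norm_neg, hnu] at hzle
      have : 0 ≤ K * A * ξ := by positivity
      rw [ha]; linarith
    have hwn : ∀ n, ∃ v, R v (y + u + u + e n) ∧ ‖z - v‖ ≤ a := by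
      intro n
      obtain ⟨v, hv, hvle⟩ := hlift z _ hz (y + u + u + e n)
      refine ⟨v, hv, hvle.trans ?_⟩
      have e1 : y + u - (y + u + u + e n) = -(u + e n) := by abel
      rw [e1, norm_neg, ha]
      have := (he n).1
      gcongr
    choose v hv hvle using hwn
    obtain ⟨n, hn⟩ := hβ a (t * A / (2 * L)) ha0 (by positivity) (w - z) (fun n => v n - z)
      hzle' (fun n => by rw [norm_sub_rev]; exact hvle n) (by
        intro m n hmn
        have h3 := h1 _ _ _ _ (hv m) (hv n)
        rw [add_sub_add_left_eq_sub] at h3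
        have h4 := hesep m n hmn
        rw [sub_sub_sub_cancel_right, div_le_iff₀ (by positivity)]
        linarith)
    rw [sub_sub_sub_cancel_right] at hn
    obtain ⟨w', hw', hw'le⟩ := hlift _ _ (hv n) y'
    refine ⟨w', hw', ?_⟩
    have h5 : ‖v n - w'‖ ≤ a := by
      have e1 : y + u + u + e n - y' = -(u - e n) := by rw [hy']; abel
      rw [e1, norm_neg] at hw'le
      refine hw'le.trans ?_
      have := (he n).2
      rw [ha]
      gcongr
    have h6 : ‖w - w'‖ ≤ ‖w - v n‖ + ‖v n - w'‖ := norm_sub_le_norm_sub_add_norm_sub _ _ _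
    have h7 : t * (1 / (2 * L * K₀)) ≤ t * A / (2 * L) / a := by
      rw [le_div_iff₀ ha0]
      calc t * (1 / (2 * L * K₀)) * a ≤ t * (1 / (2 * L * K₀)) * (K₀ * A) := by gcongr
        _ = _ := by field_simp
    have h8 : (t * (1 / (2 * L * K₀))) ^ p ≤ (t * A / (2 * L) / a) ^ p := by gcongr
    have h9 : 6 * θ ≤ c * (t * A / (2 * L) / a) ^ p := by
      have : c * (t * (1 / (2 * L * K₀))) ^ p ≤ c * (t * A / (2 * L) / a) ^ p := by gcongr
      rw [hθ]; linarith
    have h10 : K * A / 3 * (6 * θ) ≤ a * c * (t * A / (2 * L) / a) ^ p := by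
      rw [mul_assoc a]; gcongr
    have h11 : K * A * ξ ≤ K * A * θ := by gcongr
    have h12 : 0 ≤ θ * K * A₀ := by positivity
    have h13 : 3 * a = K * A + K * A * ξ + 3 * D := by rw [ha]; ring
    linarith
  have hind : ∀ n : ℕ, ∃ K, G K ∧ K ≤ K₀ - n * (θ / L) := by
    intro n
    induction n with
    | zero => exact ⟨K₀, hG0, by simp⟩
    | succ n ih =>
      obtain ⟨K, hGK, hle⟩ := ih
      have hpos : 0 ≤ n * (θ / L) := by positivity
      refine ⟨_, himp K (by linarith) hGK, ?_⟩
      have h3 : θ * (1 / L) ≤ θ * K := by gcongr; exact hlow K hGK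
      push_cast
      have : θ / L = θ * (1 / L) := by ring
      rw [this] at hle ⊢
      linarith
  obtain ⟨n, hn⟩ := exists_nat_gt (K₀ / (θ / L))
  obtain ⟨K, hGK, hle⟩ := hind n
  have h3 := hlow K hGK
  have h4 : 0 < 1 / L := by positivity
  rw [div_lt_iff₀ (by positivity)] at hn
  linarith

lemma coarse_lip {X Y : Type*} [NormedAddCommGroup X] [NormedAddCommGroup Y]
    (T : X → Y) (S : Set X) (hT : UniformQuotientOn T S) (hLip : LipschitzLargeDist T S) :
    ∃ L, 0 ≤ L ∧ ∀ x ∈ S, ∀ x' ∈ S, ‖T x - T x'‖ ≤ L * ‖x - x'‖ + 1 := by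
  obtain ⟨δ, hδ, h⟩ := hT.1 1 one_pos
  obtain ⟨L, hL⟩ := hLip δ hδ
  refine ⟨max L 0, le_max_right _ _, fun x hx x' hx' => ?_⟩
  rcases le_or_gt ‖x - x'‖ δ with h1 | h1
  · have : 0 ≤ max L 0 * ‖x - x'‖ := mul_nonneg (le_max_right _ _) (norm_nonneg _)
    linarith [h x hx x' hx' h1]
  · have h2 : ‖T x - T x'‖ / ‖x - x'‖ ≤ L := hL ⟨x, hx, x', hx', h1.le, rfl⟩
    rw [div_le_iff₀ (hδ.trans h1)] at h2
    have : L * ‖x - x'‖ ≤ max L 0 * ‖x - x'‖ := by gcongr; exact le_max_left _ _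
    linarith

lemma coarse_colip {X Y : Type*} [NormedAddCommGroup X] [NormedAddCommGroup Y] [NormedSpace ℝ Y]
    (T : X → Y) (S : Set X) (hT : UniformQuotientOn T S) :
    ∃ K, 0 ≤ K ∧ ∀ x ∈ S, ∀ y, ∃ x' ∈ S, T x' = y ∧ ‖x - x'‖ ≤ K * ‖T x - y‖ + 1 := by
  obtain ⟨δ, hδ, h⟩ := hT.2 1 one_pos
  have hind : ∀ n : ℕ, ∀ x ∈ S, ∀ y, ‖T x - y‖ ≤ n * δ → ∃ x' ∈ S, T x' = y ∧ ‖x - x'‖ ≤ n := by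
    intro n
    induction n with
    | zero =>
      intro x hx y hy
      refine ⟨x, hx, ?_, by simp⟩
      have : ‖T x - y‖ = 0 := le_antisymm (by simpa using hy) (norm_nonneg _)
      exact sub_eq_zero.1 (norm_eq_zero.1 this)
    | succ n ih =>
      intro x hx y hy
      have hn : (0:ℝ) < n + 1 := by positivity
      push_cast at hy
      set d := y - T x with hd
      have hdn : ‖d‖ ≤ (n + 1) * δ := by rw [hd, norm_sub_rev]; exact hy
      obtain ⟨x₁, hx₁, hT₁, hle⟩ := ih x hx (y - ((n + 1 : ℝ)⁻¹) • d) (by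
        have e : T x - (y - ((n + 1 : ℝ)⁻¹) • d) = (-(n / (n + 1)) : ℝ) • d := by
          have e1 : T x = y - d := by rw [hd]; abel
          have e2 : (-(n / (n + 1)) : ℝ) = (n + 1 : ℝ)⁻¹ - 1 := by field_simp; ring
          rw [e1, e2, sub_smul, one_smul]; abel
        rw [e, norm_smul, norm_neg, Real.norm_of_nonneg (by positivity), div_mul_eq_mul_div,
          div_le_iff₀ hn]
        calc (n:ℝ) * ‖d‖ ≤ n * ((n + 1) * δ) := by gcongr
          _ = _ := by ring)
      have hyb : y ∈ closedBall (T x₁) δ := by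
        rw [mem_closedBall, dist_eq_norm, hT₁, sub_sub_cancel, norm_smul,
          Real.norm_of_nonneg (by positivity), inv_mul_le_iff₀ hn]
        exact hdn
      obtain ⟨x', ⟨hx'b, hx'S⟩, hx'T⟩ := h x₁ hx₁ hyb
      refine ⟨x', hx'S, hx'T, ?_⟩
      rw [mem_closedBall, dist_eq_norm, norm_sub_rev] at hx'b
      have := norm_sub_le_norm_sub_add_norm_sub x x₁ x'
      push_cast
      linarith
  refine ⟨1 / δ, by positivity, fun x hx y => ?_⟩
  obtain ⟨x', hx', hTx', hle⟩ := hind ⌈‖T x - y‖ / δ⌉₊ x hx y (by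
    rw [← div_le_iff₀ hδ]; exact Nat.le_ceil _)
  refine ⟨x', hx', hTx', hle.trans ?_⟩
  have := (Nat.ceil_lt_add_one (show 0 ≤ ‖T x - y‖ / δ by positivity)).le
  rw [one_div_mul_eq_div]
  exact this

/-- Corollary `g_thm2`: a uniform quotient (Lipschitz for large
distances) of a subset of a quotient of a subspace of an `ℓ_p`-sum of
finite-dimensional spaces contains no isomorphic copy of `ℓ_q` for `q > p`. -/
theorem stmt9 (p : ℝ) (hp : 1 < p) [Fact (1 ≤ ENNReal.ofReal p)]
    (E : ℕ → Type*) [∀ k, NormedAddCommGroup (E k)] [∀ k, NormedSpace ℝ (E k)]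
    [∀ k, FiniteDimensional ℝ (E k)] [∀ k, Nontrivial (E k)]
    (W : Subspace ℝ (lp E (ENNReal.ofReal p)))
    (hW : IsClosed (W : Set (lp E (ENNReal.ofReal p))))
    {X Y : Type*} [NormedAddCommGroup X] [NormedSpace ℝ X] [CompleteSpace X]
    [NormedAddCommGroup Y] [NormedSpace ℝ Y] [CompleteSpace Y]
    (Q : W →L[ℝ] X) (hQ : Function.Surjective Q)
    (S : Set X) (T : X → Y) (hsurj : T '' S = Set.univ)
    (hT : UniformQuotientOn T S) (hLip : LipschitzLargeDist T S) :
    ¬ ∃ (q : ℝ) (hq : p < q) (Z : Subspace ℝ Y), IsClosed (Z : Set Y) ∧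
        (letI : Fact (1 ≤ ENNReal.ofReal q) := ⟨ENNReal.one_le_ofReal.mpr (hp.trans hq).le⟩
         Nonempty (Z ≃L[ℝ] lp (fun _ : ℕ => ℝ) (ENNReal.ofReal q))) := by
  rintro ⟨q, hq, Z, hZ, ⟨j⟩⟩
  haveI : Fact (1 ≤ ENNReal.ofReal q) := ⟨ENNReal.one_le_ofReal.mpr (hp.trans hq).le⟩
  haveI : ∀ k, CompleteSpace (E k) := fun k => FiniteDimensional.complete ℝ (E k)
  haveI : CompleteSpace W := hW.completeSpace_coe
  have hp0 : 0 < p := by linarith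
  have hq0 : 0 < q := by linarith
  have hβ : BetaPow W p := by
    obtain ⟨c, hc, hβ⟩ := betaPow_of_hasProj p hp (hasProj_lp p hp E)
    refine ⟨c, hc, fun a s ha hs x w hx hw hsep => ?_⟩
    obtain ⟨n, hn⟩ := hβ a s ha hs (x : lp E (ENNReal.ofReal p)) (fun n => (w n : lp E (ENNReal.ofReal p)))
      hx hw hsep
    exact ⟨n, hn⟩
  obtain ⟨L, hL, hLT⟩ := coarse_lip T S hT hLip
  obtain ⟨K, hK, hKT⟩ := coarse_colip T S hT
  obtain ⟨C, hC, hCQ⟩ := Q.exists_preimage_norm_le hQ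
  haveI : Nontrivial (lp (fun _ : ℕ => ℝ) (ENNReal.ofReal q)) := by
    refine ⟨lp.single _ 0 1, 0, fun h => ?_⟩
    have h1 := lp.norm_single (E := fun _ : ℕ => ℝ) (p := ENNReal.ofReal q) (by simpa using hq0) 0 1
    rw [h] at h1
    simp at h1
  let J : Z →L[ℝ] lp (fun _ : ℕ => ℝ) (ENNReal.ofReal q) := j
  let J' : lp (fun _ : ℕ => ℝ) (ENNReal.ofReal q) →L[ℝ] Z := j.symm
  have hJJ' : ∀ y, J (J' y) = y := fun y => j.apply_symm_apply y
  refine core p q hp hq hβ (smoothSeq_lp q (hp.trans hq))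
    (fun w y => Q w ∈ S ∧ T (Q w) = (J' y : Y)) ?_ (‖J‖ * L * ‖Q‖ + 1) ‖J‖
    (C * K * ‖J'‖) C (by positivity) ?_ ?_
  · have h0 : (J' 0 : Y) ∈ T '' S := by rw [hsurj]; trivial
    obtain ⟨x, hx, hTx⟩ := h0
    obtain ⟨w, rfl⟩ := hQ x
    exact ⟨w, 0, hx, hTx⟩
  · rintro w y w' y' ⟨h1, h2⟩ ⟨h3, h4⟩
    have h5 := hLT _ h1 _ h3
    rw [h2, h4, ← map_sub] at h5
    have h6 : ‖y - y'‖ ≤ ‖J‖ * ‖J' y - J' y'‖ := by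
      have := J.le_opNorm (J' y - J' y')
      rwa [map_sub, hJJ', hJJ'] at this
    have h7 : ‖(J' y : Y) - (J' y' : Y)‖ = ‖J' y - J' y'‖ := rfl
    rw [h7] at h5
    have h8 := Q.le_opNorm (w - w')
    calc ‖y - y'‖ ≤ ‖J‖ * (L * (‖Q‖ * ‖w - w'‖) + 1) :=
          h6.trans (mul_le_mul_of_nonneg_left (h5.trans (by gcongr)) (ContinuousLinearMap.opNorm_nonneg J))
      _ ≤ _ := by nlinarith [norm_nonneg (w - w')]
  · rintro w y ⟨h1, h2⟩ y'
    obtain ⟨x', hx', hTx', hle⟩ := hKT _ h1 (J' y' : Y)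
    obtain ⟨v, hv, hvle⟩ := hCQ (Q w - x')
    have hq' : Q (w - v) = x' := by rw [map_sub, hv]; abel
    refine ⟨w - v, ⟨by rw [hq']; exact hx', by rw [hq']; exact hTx'⟩, ?_⟩
    rw [sub_sub_cancel]
    have h7 : ‖(J' y : Y) - (J' y' : Y)‖ = ‖J' (y - y')‖ := by rw [map_sub]; rfl
    rw [h2, h7] at hle
    have h8 := J'.le_opNorm (y - y')
    calc ‖v‖ ≤ C * (K * (‖J'‖ * ‖y - y'‖) + 1) :=
          hvle.trans (mul_le_mul_of_nonneg_left (hle.trans (by gcongr)) hC.le)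
      _ = _ := by ring

end
end
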